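/- arXiv:1811.11545 — 2 statements merged into one kernel-verified Lean document; each statement's English description precedes it below -/
import Mathlib

section
/- Let α be an irrational real number and let Z ⊆ 𝕋² (where 𝕋 = ℝ/ℤ) be a non-empty closed set that is invariant under the map S(x,y) = (x + α mod 1, 2y mod 1), i.e. S(Z) ⊆ Z. Then the set Σ(Z) = {x + y mod 1 : (x,y) ∈ Z} ⊆ 𝕋 has Hausdorff dimension equal to 1. -/
open MeasureTheory

/-- The integer formed by the first `n` binary digits of a point of `ℝ/ℤ`. -/
noncomputable def dyadicCode (n : ℕ) (y : AddCircle (1 : ℝ)) : ℕ :=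
  ⌊(2 : ℝ) ^ n * (AddCircle.equivIco 1 0 y : ℝ)⌋₊

theorem dyadicCode_lt (n : ℕ) (y : AddCircle (1 : ℝ)) : dyadicCode n y < 2 ^ n := by
  have h := (AddCircle.equivIco 1 0 y).2
  rw [Set.mem_Ico] at h
  rw [dyadicCode, Nat.floor_lt (by have := h.1; positivity)]
  push_cast
  have : (0 : ℝ) < 2 ^ n := by positivity
  nlinarith [h.2]

theorem dyadicCode_add (a b : ℕ) (y : AddCircle (1 : ℝ)) :
    dyadicCode (a + b) y = 2 ^ b * dyadicCode a y + dyadicCode b ((2 ^ a : ℕ) • y) := by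
  have h := (AddCircle.equivIco 1 0 y).2
  have hy : ((AddCircle.equivIco 1 0 y : ℝ) : AddCircle (1 : ℝ)) = y :=
    (AddCircle.equivIco 1 0).symm_apply_apply y
  set r : ℝ := (AddCircle.equivIco 1 0 y : ℝ) with hr
  have h2 : (AddCircle.equivIco 1 0 ((2 ^ a : ℕ) • y) : ℝ) = Int.fract (2 ^ a * r) := by
    have : (2 ^ a : ℕ) • y = ((2 ^ a * r : ℝ) : AddCircle (1 : ℝ)) := by
      rw [← hy, ← AddCircle.coe_nsmul]
      simp
    rw [this]
    simp
  have h0 : 0 ≤ r := h.1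
  rw [dyadicCode, dyadicCode, dyadicCode, h2, ← hr, add_comm (2 ^ b * _), ← Nat.floor_add_natCast
    (mul_nonneg (by positivity) (Int.fract_nonneg _))]
  congr 1
  push_cast
  rw [natCast_floor_eq_intCast_floor (by positivity : 0 ≤ 2 ^ a * r), Int.fract]
  ring

theorem dist_dyadicCode_le (n : ℕ) (y : AddCircle (1 : ℝ)) :
    dist y ((dyadicCode n y / 2 ^ n : ℝ) : AddCircle (1 : ℝ)) ≤ (1 / 2) ^ n := by
  have h := (AddCircle.equivIco 1 0 y).2
  have hy : ((AddCircle.equivIco 1 0 y : ℝ) : AddCircle (1 : ℝ)) = y :=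
    (AddCircle.equivIco 1 0).symm_apply_apply y
  rw [dyadicCode]
  set r : ℝ := (AddCircle.equivIco 1 0 y : ℝ) with hr
  have h0 : 0 ≤ r := h.1
  conv_lhs => rw [← hy]
  rw [dist_eq_norm, ← AddCircle.coe_sub]
  refine (QuotientAddGroup.norm_mk_le_norm (S := AddSubgroup.zmultiples (1 : ℝ))).trans ?_
  have h3 := Nat.floor_le (by positivity : 0 ≤ 2 ^ n * r)
  have h4 := Nat.lt_floor_add_one (2 ^ n * r)
  have h5 : (0 : ℝ) < 2 ^ n := by positivity
  have h6 : r - ⌊2 ^ n * r⌋₊ / 2 ^ n = (2 ^ n * r - ⌊2 ^ n * r⌋₊) / 2 ^ n := by field_simp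
  rw [h6, Real.norm_eq_abs, abs_of_nonneg (by apply div_nonneg <;> linarith), one_div, inv_pow,
    ← one_div]
  gcongr
  linarith

theorem dimH_addCircle_le (s : Set (AddCircle (1 : ℝ))) : dimH s ≤ 1 := by
  have hl : LipschitzWith 1 ((↑) : ℝ → AddCircle (1 : ℝ)) := by
    refine LipschitzWith.of_dist_le_mul fun x y => ?_
    rw [dist_eq_norm, dist_eq_norm, ← AddCircle.coe_sub, NNReal.coe_one, one_mul]
    exact QuotientAddGroup.norm_mk_le_norm (S := AddSubgroup.zmultiples (1 : ℝ))
  refine (dimH_mono (Set.subset_univ s)).trans ?_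
  rw [← (QuotientAddGroup.mk_surjective (s := AddSubgroup.zmultiples (1 : ℝ))).range_eq]
  exact (hl.dimH_range_le).trans_eq Real.dimH_univ

theorem IsCompact.exists_dyadic_cover_of_dimH_lt {X : Type*} [MetricSpace X] [Nonempty X]
    {K : Set X} (hK : IsCompact K) {s : NNReal} (hs : dimH K < s) (hs1 : s ≤ 1) {ε : ℝ}
    (hε : 0 < ε) (hε1 : ε ≤ 1) :
    ∃ (J : Finset ℕ) (p : ℕ → X) (m : ℕ → ℕ), K ⊆ ⋃ i ∈ J, Metric.ball (p i) ((1 / 2) ^ m i) ∧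
      ∑ i ∈ J, (2 : ℝ) ^ (-((s : ℝ) * m i)) ≤ ε := by
  borelize X
  have hs0 : (0 : ℝ) < s := by
    have : (0 : ENNReal) < s := pos_of_gt hs
    exact_mod_cast this
  have h0 := hausdorffMeasure_of_dimH_lt hs
  rw [Measure.hausdorffMeasure_apply] at h0
  have h1 := (iSup₂_le_iff.1 h0.le) 1 one_pos
  obtain ⟨δ, hδ, hδε⟩ : ∃ δ : NNReal, 0 < δ ∧ 4 * (δ : ℝ) = ε :=
    ⟨(ε / 4).toNNReal, by simpa using hε, by rw [Real.coe_toNNReal _ (by positivity)]; ring⟩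
  have hδ' : (0 : ENNReal) < δ := by exact_mod_cast hδ
  have h2 := h1.trans_lt hδ'
  simp only [iInf_lt_iff] at h2
  obtain ⟨t, ht, -, hsum⟩ := h2
  obtain ⟨e, he0, hesum⟩ := ENNReal.exists_pos_sum_of_countable hδ'.ne' ℕ
  set T : ℕ → ENNReal := fun n => ⨆ _ : (t n).Nonempty, Metric.ediam (t n) ^ (s : ℝ) with hT
  have htot : ∑' n, (T n + e n) ≤ 2 * δ := by
    rw [ENNReal.tsum_add, two_mul]
    exact add_le_add hsum.le hesum.le
  have key : ∀ n, ∃ (p : X) (m : ℕ), t n ⊆ Metric.ball p ((1 / 2) ^ m) ∧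
      ENNReal.ofReal ((2 : ℝ) ^ (-((s : ℝ) * m))) ≤ 2 * (T n + e n) := by
    intro n
    have hle : T n + e n ≤ 2 * δ := (ENNReal.le_tsum n).trans htot
    have hfin : T n + e n ≠ ⊤ := ne_top_of_le_ne_top (by finiteness) hle
    have hpos : 0 < T n + e n := by
      have : (0 : ENNReal) < e n := by exact_mod_cast he0 n
      exact this.trans_le le_add_self
    set a := (T n + e n).toReal with ha
    have ha0 : 0 < a := ENNReal.toReal_pos hpos.ne' hfin
    have ha1 : a ≤ 1 := by
      have := ENNReal.toReal_mono (by finiteness) hle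
      simp at this
      linarith
    have hc0 : 0 < a ^ (1 / (s : ℝ)) := by positivity
    have hc1 : a ^ (1 / (s : ℝ)) ≤ 1 := Real.rpow_le_one ha0.le ha1 (by positivity)
    obtain ⟨m, hm1, hm2⟩ := exists_nat_pow_near_of_lt_one hc0 hc1 (by norm_num : (0 : ℝ) < 1 / 2)
      (by norm_num)
    have hcs : (a ^ (1 / (s : ℝ))) ^ (s : ℝ) = a := by
      rw [← Real.rpow_mul ha0.le, one_div_mul_cancel hs0.ne', Real.rpow_one]
    have hbd : ENNReal.ofReal ((2 : ℝ) ^ (-((s : ℝ) * m))) ≤ 2 * (T n + e n) := by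
      have e1 : ((1 / 2 : ℝ) ^ (m + 1)) ^ (s : ℝ) ≤ a := by
        rw [← hcs]
        exact Real.rpow_le_rpow (by positivity) hm1.le hs0.le
      have e2 : ((1 / 2 : ℝ) ^ (m + 1)) ^ (s : ℝ)
          = (2 : ℝ) ^ (-((s : ℝ) * m)) * (2 : ℝ) ^ (-(s : ℝ)) := by
        rw [← Real.rpow_add two_pos, ← Real.rpow_natCast, ← Real.rpow_mul (by norm_num), one_div,
          Real.inv_rpow two_pos.le, ← Real.rpow_neg two_pos.le]
        congr 1
        push_cast
        ring
      have e3 : (1 / 2 : ℝ) ≤ (2 : ℝ) ^ (-(s : ℝ)) := by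
        have : (2 : ℝ) ^ (-1 : ℝ) ≤ (2 : ℝ) ^ (-(s : ℝ)) :=
          Real.rpow_le_rpow_of_exponent_le one_le_two (by
            have : (s : ℝ) ≤ 1 := by exact_mod_cast hs1
            linarith)
        rwa [Real.rpow_neg_one, ← one_div] at this
      have e4 : (0 : ℝ) < (2 : ℝ) ^ (-((s : ℝ) * m)) := by positivity
      have e5 : (2 : ℝ) ^ (-((s : ℝ) * m)) ≤ 2 * a := by nlinarith
      calc _ ≤ ENNReal.ofReal (2 * a) := ENNReal.ofReal_le_ofReal e5
        _ = _ := by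
          rw [ENNReal.ofReal_mul two_pos.le, ha, ENNReal.ofReal_toReal hfin]
          simp
    rcases (t n).eq_empty_or_nonempty with hn | ⟨p, hp⟩
    · exact ⟨Classical.arbitrary X, m, by simp [hn], hbd⟩
    · refine ⟨p, m, fun q hq => ?_, hbd⟩
      have hTn : T n = Metric.ediam (t n) ^ (s : ℝ) := by
        simp only [hT]
        exact ciSup_pos ⟨p, hp⟩
      have hlt : edist q p ^ (s : ℝ) < T n + e n := by
        have h3 : edist q p ^ (s : ℝ) ≤ T n := by
          rw [hTn]
          exact ENNReal.rpow_le_rpow (Metric.edist_le_ediam_of_mem hq hp) hs0.le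
        refine h3.trans_lt (ENNReal.lt_add_right (ne_top_of_le_ne_top hfin le_self_add) ?_)
        exact_mod_cast (he0 n).ne'
      have h4 : dist q p ^ (s : ℝ) < a := by
        rw [dist_edist, ENNReal.toReal_rpow]
        exact (ENNReal.toReal_lt_toReal hlt.ne_top hfin).2 hlt
      rw [← hcs] at h4
      exact Metric.mem_ball.2
        (((Real.rpow_lt_rpow_iff dist_nonneg hc0.le hs0).1 h4).trans_le hm2)
  choose p m hpm hbd using key
  obtain ⟨J, hJ⟩ := hK.elim_finite_subcover (fun n => Metric.ball (p n) ((1 / 2) ^ m n))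
    (fun n => Metric.isOpen_ball) (ht.trans (Set.iUnion_mono hpm))
  refine ⟨J, p, m, hJ, ?_⟩
  have hfinal : ENNReal.ofReal (∑ i ∈ J, (2 : ℝ) ^ (-((s : ℝ) * m i))) ≤ ENNReal.ofReal ε := by
    rw [ENNReal.ofReal_sum_of_nonneg (fun i _ => by positivity)]
    calc _ ≤ ∑ i ∈ J, 2 * (T i + e i) := Finset.sum_le_sum fun i _ => hbd i
      _ = 2 * ∑ i ∈ J, (T i + e i) := by rw [Finset.mul_sum]
      _ ≤ 2 * ∑' i, (T i + e i) := by gcongr; exact ENNReal.sum_le_tsum J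
      _ ≤ 2 * (2 * δ) := by gcongr
      _ = ENNReal.ofReal ε := by
        rw [← hδε, ENNReal.ofReal_mul (by norm_num), ENNReal.ofReal_coe_nnreal, ← mul_assoc]
        norm_num
  exact (ENNReal.ofReal_le_ofReal_iff hε.le).1 hfinal

theorem le_of_visit_recursion {X ι : Type*} [AddCommMonoid X] (a : X) (B : Set X) (f : X → ℕ → ℝ)
    (G : X → Finset ι) (m : ι → ℕ) (M : ℕ) (t : ℝ) (ht : -1 ≤ t) (h0 : ∀ x n, f x n ≤ 2 ^ n)
    (h1 : ∀ x n, f x (n + 1) ≤ 2 * f (x + a) n)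
    (hm : ∀ x, ∀ j ∈ G x, 1 ≤ m j ∧ m j ≤ M)
    (hG : ∀ x ∉ B, ∀ n ≥ M, f x n ≤ ∑ j ∈ G x, f (x + m j • a) (n - m j))
    (hφ : ∀ x ∉ B, ∑ j ∈ G x, (2 : ℝ) ^ (-(t * m j)) ≤ 1) (n : ℕ) (x : X) :
    f x n ≤ 4 ^ M *
      (2 : ℝ) ^ (t * n + 2 * ∑ k ∈ Finset.range n, B.indicator (fun _ => (1 : ℝ)) (x + k • a)) := by
  induction n using Nat.strong_induction_on generalizing x with
  | _ n ih =>
  have hind : ∀ z, 0 ≤ B.indicator (fun _ => (1 : ℝ)) z :=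
    fun z => Set.indicator_nonneg (fun _ _ => zero_le_one) z
  rcases le_or_gt n M with hn | hn
  · have e1 : (2 : ℝ) ^ n ≤ 2 ^ M := pow_le_pow_right₀ one_le_two hn
    have e2 : (2 : ℝ) ^ (-(M : ℝ)) ≤ (2 : ℝ) ^ (t * n + 2 * ∑ k ∈ Finset.range n,
        B.indicator (fun _ => (1 : ℝ)) (x + k • a)) := by
      apply Real.rpow_le_rpow_of_exponent_le one_le_two
      have : 0 ≤ ∑ k ∈ Finset.range n, B.indicator (fun _ => (1 : ℝ)) (x + k • a) :=
        Finset.sum_nonneg fun k _ => hind _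
      have hn' : (n : ℝ) ≤ M := by exact_mod_cast hn
      nlinarith [Nat.cast_nonneg (α := ℝ) n]
    calc f x n ≤ 2 ^ M := (h0 x n).trans e1
      _ = 4 ^ M * (2 : ℝ) ^ (-(M : ℝ)) := by
        rw [Real.rpow_neg two_pos.le, Real.rpow_natCast, show (4 : ℝ) = 2 * 2 by norm_num, mul_pow]
        field_simp
      _ ≤ _ := by gcongr
  · by_cases hx : x ∈ B
    · obtain ⟨n, rfl⟩ : ∃ l, n = l + 1 := ⟨n - 1, by omega⟩
      refine (h1 x n).trans ?_
      rw [Finset.sum_range_succ']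
      have hsum : ∑ k ∈ Finset.range n, B.indicator (fun _ => (1 : ℝ)) (x + (k + 1) • a)
          = ∑ k ∈ Finset.range n, B.indicator (fun _ => (1 : ℝ)) (x + a + k • a) :=
        Finset.sum_congr rfl fun k _ => by rw [add_smul, one_smul, add_comm (k • a), add_assoc]
      have hx1 : B.indicator (fun _ => (1 : ℝ)) (x + 0 • a) = 1 := by simp [hx]
      rw [hsum, hx1]
      set V := ∑ k ∈ Finset.range n, B.indicator (fun _ => (1 : ℝ)) (x + a + k • a)
      calc 2 * f (x + a) n ≤ 2 * (4 ^ M * (2 : ℝ) ^ (t * n + 2 * V)) := by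
            gcongr; exact ih n (by omega) (x + a)
        _ = 4 ^ M * (2 : ℝ) ^ (t * n + 2 * V + 1) := by
            rw [Real.rpow_add two_pos _ 1, Real.rpow_one]; ring
        _ ≤ _ := by
            refine mul_le_mul_of_nonneg_left
              (Real.rpow_le_rpow_of_exponent_le one_le_two ?_) (by positivity)
            push_cast
            linarith
    · calc f x n ≤ ∑ j ∈ G x, f (x + m j • a) (n - m j) := hG x hx n hn.le
        _ ≤ ∑ j ∈ G x, 4 ^ M * (2 : ℝ) ^ (t * n + 2 * ∑ k ∈ Finset.range n,
              B.indicator (fun _ => (1 : ℝ)) (x + k • a)) * (2 : ℝ) ^ (-(t * m j)) := by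
            refine Finset.sum_le_sum fun j hj => ?_
            obtain ⟨hj1, hj2⟩ := hm x j hj
            refine (ih (n - m j) (by omega) _).trans ?_
            rw [mul_assoc, ← Real.rpow_add two_pos]
            refine mul_le_mul_of_nonneg_left
              (Real.rpow_le_rpow_of_exponent_le one_le_two ?_) (by positivity)
            have hV : ∑ k ∈ Finset.range (n - m j),
                B.indicator (fun _ => (1 : ℝ)) (x + m j • a + k • a)
                ≤ ∑ k ∈ Finset.range n, B.indicator (fun _ => (1 : ℝ)) (x + k • a) := by
              conv_rhs => rw [← Nat.add_sub_of_le (hj2.trans hn.le), Finset.sum_range_add]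
              simp only [add_smul, ← add_assoc]
              exact le_add_of_nonneg_left (Finset.sum_nonneg fun k _ => hind _)
            rw [Nat.cast_sub (hj2.trans hn.le)]
            linarith
        _ = 4 ^ M * (2 : ℝ) ^ (t * n + 2 * ∑ k ∈ Finset.range n,
              B.indicator (fun _ => (1 : ℝ)) (x + k • a)) *
              ∑ j ∈ G x, (2 : ℝ) ^ (-(t * m j)) := (Finset.mul_sum _ _ _).symm
        _ ≤ _ := mul_le_of_le_one_right (by positivity) (hφ x hx)

theorem exists_sum_indicator_le (a : AddCircle (1 : ℝ)) {B : Set (AddCircle (1 : ℝ))}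
    (hB : MeasurableSet B) (n : ℕ) :
    ∃ x, ∑ k ∈ Finset.range n, B.indicator (fun _ => (1 : ℝ)) (x + k • a)
      ≤ n * (volume : Measure (AddCircle (1 : ℝ))).real B := by
  have : IsProbabilityMeasure (volume : Measure (AddCircle (1 : ℝ))) := ⟨by simp⟩
  have hi : Integrable (B.indicator (fun _ => (1 : ℝ))) (volume : Measure (AddCircle (1 : ℝ))) :=
    (integrable_const 1).indicator hB
  have hik : ∀ k ∈ Finset.range n, Integrable
      (fun x => B.indicator (fun _ => (1 : ℝ)) (x + k • a))
      (volume : Measure (AddCircle (1 : ℝ))) := fun k _ => hi.comp_add_right (k • a)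
  obtain ⟨x, hx⟩ := exists_le_integral (integrable_finsetSum _ hik)
  refine ⟨x, hx.trans_eq ?_⟩
  rw [integral_finsetSum _ hik]
  have : ∀ k ∈ Finset.range n, ∫ x, B.indicator (fun _ => (1 : ℝ)) (x + k • a)
      ∂(volume : Measure (AddCircle (1 : ℝ))) = (volume : Measure (AddCircle (1 : ℝ))).real B := by
    intro k _
    rw [integral_add_right_eq_self (B.indicator (fun _ => (1 : ℝ))) (k • a)]
    simp [integral_indicator hB]
  rw [Finset.sum_congr rfl this]
  simp

theorem exists_forall_exists_dist_add_nsmul_lt {α : ℝ} (hα : Irrational α) {r : ℝ} (hr : 0 < r) :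
    ∃ K : ℕ, ∀ x z : AddCircle (1 : ℝ), ∃ k ≤ K,
      dist (x + k • (α : AddCircle (1 : ℝ))) z < r := by
  have hd : DenseRange (· • (α : AddCircle (1 : ℝ)) : ℤ → AddCircle (1 : ℝ)) :=
    AddCircle.denseRange_zsmul_coe_iff.2 (by simpa using hα)
  obtain ⟨F, hF⟩ := (isCompact_univ (X := AddCircle (1 : ℝ))).elim_finite_subcover
    (fun k : ℤ => {y | dist (k • (α : AddCircle (1 : ℝ))) y < r})
    (fun k => isOpen_lt (by fun_prop) (by fun_prop)) (fun y _ => by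
      obtain ⟨k, hk⟩ := hd.exists_dist_lt y hr
      exact Set.mem_iUnion.2 ⟨k, by simpa [dist_comm] using hk⟩)
  set L := F.sup Int.natAbs
  refine ⟨2 * L, fun x z => ?_⟩
  obtain ⟨k, hkF, hk⟩ := Set.mem_iUnion₂.1
    (hF (Set.mem_univ (z - (x + L • (α : AddCircle (1 : ℝ))))))
  have hkL : k.natAbs ≤ L := Finset.le_sup hkF
  refine ⟨(k + L).toNat, by omega, ?_⟩
  have e : ((k + L).toNat) • (α : AddCircle (1 : ℝ)) = k • (α : AddCircle (1 : ℝ))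
      + L • (α : AddCircle (1 : ℝ)) := by
    rw [← natCast_zsmul, Int.toNat_of_nonneg (by omega), add_smul, natCast_zsmul]
  replace hk : dist (k • (α : AddCircle (1 : ℝ))) (z - (x + L • (α : AddCircle (1 : ℝ)))) < r := hk
  rw [dist_eq_norm] at hk
  rw [e, dist_eq_norm]
  convert hk using 2
  abel

open scoped Classical in
/-- The `n`-digit binary codes of the second coordinates of the points of `Z` lying over `E`. -/
noncomputable def fiberCodes (Z : Set (AddCircle (1 : ℝ) × AddCircle (1 : ℝ)))
    (E : Set (AddCircle (1 : ℝ))) (n : ℕ) : Finset ℕ :=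
  (Finset.range (2 ^ n)).filter fun w => ∃ p ∈ Z, p.1 ∈ E ∧ dyadicCode n p.2 = w

section fiberCodes

variable {Z : Set (AddCircle (1 : ℝ) × AddCircle (1 : ℝ))} {E : Set (AddCircle (1 : ℝ))}

theorem mem_fiberCodes {n w : ℕ} :
    w ∈ fiberCodes Z E n ↔ ∃ p ∈ Z, p.1 ∈ E ∧ dyadicCode n p.2 = w := by
  simp only [fiberCodes, Finset.mem_filter, Finset.mem_range, and_iff_right_iff_imp]
  rintro ⟨p, -, -, rfl⟩
  exact dyadicCode_lt n p.2

theorem card_fiberCodes_le (n : ℕ) : (fiberCodes Z E n).card ≤ 2 ^ n := by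
  refine (Finset.card_le_card fun w hw => ?_).trans (Finset.card_range (2 ^ n)).le
  obtain ⟨p, -, -, rfl⟩ := mem_fiberCodes.1 hw
  exact Finset.mem_range.2 (dyadicCode_lt n p.2)

theorem card_fiberCodes_ball_le_sum {ι : Type*} {a : AddCircle (1 : ℝ)}
    (hZ : ∀ p ∈ Z, ∀ k : ℕ, (p.1 + k • a, (2 ^ k : ℕ) • p.2) ∈ Z)
    {G : Finset ι} {m w : ι → ℕ}
    {x : AddCircle (1 : ℝ)} {r : ℝ} {n : ℕ} (hm : ∀ j ∈ G, m j ≤ n)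
    (hG : ∀ p ∈ Z, p.1 ∈ Metric.ball x r → ∃ j ∈ G, dyadicCode (m j) p.2 = w j) :
    (fiberCodes Z (Metric.ball x r) n).card
      ≤ ∑ j ∈ G, (fiberCodes Z (Metric.ball (x + m j • a) r) (n - m j)).card := by
  classical
  have hsub : fiberCodes Z (Metric.ball x r) n ⊆ G.biUnion fun j =>
      (fiberCodes Z (Metric.ball (x + m j • a) r) (n - m j)).image
        fun v => 2 ^ (n - m j) * w j + v := by
    intro v hv
    obtain ⟨p, hp, hpx, rfl⟩ := mem_fiberCodes.1 hv
    obtain ⟨j, hj, hjw⟩ := hG p hp hpx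
    refine Finset.mem_biUnion.2 ⟨j, hj, Finset.mem_image.2
      ⟨dyadicCode (n - m j) ((2 ^ m j : ℕ) • p.2), mem_fiberCodes.2 ⟨_, hZ p hp (m j), ?_, rfl⟩, ?_⟩⟩
    · simpa using hpx
    · rw [← hjw, ← dyadicCode_add, Nat.add_sub_of_le (hm j hj)]
  refine (Finset.card_le_card hsub).trans (Finset.card_biUnion_le.trans ?_)
  exact Finset.sum_le_sum fun j _ => Finset.card_image_le

theorem card_fiberCodes_ball_succ_le {a : AddCircle (1 : ℝ)}
    (hZ : ∀ p ∈ Z, ∀ k : ℕ, (p.1 + k • a, (2 ^ k : ℕ) • p.2) ∈ Z)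
    (x : AddCircle (1 : ℝ)) (r : ℝ) (n : ℕ) :
    (fiberCodes Z (Metric.ball x r) (n + 1)).card
      ≤ 2 * (fiberCodes Z (Metric.ball (x + a) r) n).card := by
  have h := card_fiberCodes_ball_le_sum (n := n + 1) (r := r) (x := x) hZ (G := Finset.range 2)
    (m := fun _ => 1) (w := id) (by simp)
    (fun p _ _ => ⟨_, Finset.mem_range.2 (dyadicCode_lt 1 p.2), rfl⟩)
  simpa using h

theorem card_fiberCodes_univ_le {a : AddCircle (1 : ℝ)}
    (hZ : ∀ p ∈ Z, ∀ k : ℕ, (p.1 + k • a, (2 ^ k : ℕ) • p.2) ∈ Z)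
    {x : AddCircle (1 : ℝ)} {r : ℝ} {K : ℕ}
    (hK : ∀ z : AddCircle (1 : ℝ), ∃ k ≤ K, dist (z + k • a) x < r) (n : ℕ) :
    (fiberCodes Z Set.univ n).card
      ≤ (K + 1) * 2 ^ K * (fiberCodes Z (Metric.ball x r) n).card := by
  classical
  have hsub : fiberCodes Z Set.univ n ⊆ (Finset.range (K + 1)).biUnion fun k =>
      (Finset.range (2 ^ k) ×ˢ fiberCodes Z (Metric.ball x r) n).image
        fun q => (2 ^ n * q.1 + q.2) / 2 ^ k := by
    intro v hv
    obtain ⟨p, hp, -, rfl⟩ := mem_fiberCodes.1 hv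
    obtain ⟨k, hkK, hk⟩ := hK p.1
    refine Finset.mem_biUnion.2 ⟨k, Finset.mem_range.2 (by omega), Finset.mem_image.2
      ⟨(dyadicCode k p.2, dyadicCode n ((2 ^ k : ℕ) • p.2)), Finset.mem_product.2
        ⟨Finset.mem_range.2 (dyadicCode_lt k p.2), mem_fiberCodes.2 ⟨_, hZ p hp k, hk, rfl⟩⟩, ?_⟩⟩
    simp only
    rw [← dyadicCode_add, add_comm, dyadicCode_add, Nat.mul_add_div (by positivity),
      Nat.div_eq_of_lt (dyadicCode_lt _ _), add_zero]
  refine (Finset.card_le_card hsub).trans (Finset.card_biUnion_le.trans ?_)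
  calc _ ≤ ∑ _k ∈ Finset.range (K + 1), 2 ^ K * (fiberCodes Z (Metric.ball x r) n).card := by
        refine Finset.sum_le_sum fun k hk => Finset.card_image_le.trans ?_
        rw [Finset.card_product, Finset.card_range]
        gcongr
        · exact one_le_two
        · exact Nat.lt_succ_iff.1 (Finset.mem_range.1 hk)
    _ = _ := by simp [mul_assoc]

end fiberCodes

theorem volume_real_ball_addCircle_le (c : AddCircle (1 : ℝ)) {ρ : ℝ} (hρ : 0 ≤ ρ) :
    (volume : Measure (AddCircle (1 : ℝ))).real (Metric.ball c ρ) ≤ 2 * ρ := by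
  refine ENNReal.toReal_le_of_le_ofReal (by positivity) ?_
  refine (measure_mono Metric.ball_subset_closedBall).trans ?_
  rw [AddCircle.volume_closedBall]
  exact ENNReal.ofReal_le_ofReal (min_le_right _ _)

/-- If the sum set of `Z` has dimension less than `s`, then every exponential growth rate bounding
the number of binary codes of `Z` can be lowered by a fixed amount. -/
theorem exists_card_fiberCodes_le_of_dimH_lt {α : ℝ} (hα : Irrational α)
    {Z : Set (AddCircle (1 : ℝ) × AddCircle (1 : ℝ))} (hZcl : IsClosed Z)
    (hZ : ∀ p ∈ Z, ∀ k : ℕ,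
      (p.1 + k • (α : AddCircle (1 : ℝ)), (2 ^ k : ℕ) • p.2) ∈ Z)
    {s : NNReal} (hs1 : s < 1) (hs : dimH ((fun p => p.1 + p.2) '' Z) < s)
    {u C : ℝ} (hu : 0 ≤ u) (hC : 0 < C)
    (h : ∀ n : ℕ, ((fiberCodes Z Set.univ n).card : ℝ) ≤ C * 2 ^ (u * n)) :
    ∃ C' > 0, ∀ n : ℕ,
      ((fiberCodes Z Set.univ n).card : ℝ) ≤ C' * 2 ^ ((u - (1 - s) / 2) * n) := by
  classical
  have hs1' : (s : ℝ) < 1 := by exact_mod_cast hs1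
  have hs0' : (0 : ℝ) ≤ s := s.2
  set μ := (volume : Measure (AddCircle (1 : ℝ))) with hμ
  have : IsProbabilityMeasure μ := ⟨by simp [hμ]⟩
  set ε : ℝ := min (1 / 2) ((1 - s) / (24 * C)) with hε
  have hε0 : 0 < ε := lt_min (by norm_num) (div_pos (by linarith) (by positivity))
  have hεC : 6 * C * ε ≤ (1 - s) / 4 := by
    have : ε ≤ (1 - s) / (24 * C) := min_le_right _ _
    rw [le_div_iff₀ (by positivity)] at this
    linarith
  have hcomp : IsCompact ((fun p => p.1 + p.2) '' Z) :=
    hZcl.isCompact.image (by fun_prop)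
  obtain ⟨J, c, l, hJ, hsum⟩ := hcomp.exists_dyadic_cover_of_dimH_lt hs hs1.le hε0
    ((min_le_left _ _).trans (by norm_num))
  have hl1 : ∀ i ∈ J, 1 ≤ l i := by
    intro i hi
    by_contra hcon
    have h0 : l i = 0 := by omega
    have h1 := (Finset.single_le_sum (f := fun i => (2 : ℝ) ^ (-((s : ℝ) * l i)))
      (fun i _ => by positivity) hi).trans hsum
    have h2 : ε ≤ 1 / 2 := min_le_left _ _
    simp only [h0] at h1
    norm_num at h1
    linarith
  set t : ℝ := u - (1 - s) with ht
  set M := J.sup l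
  have hlM : ∀ i ∈ J, l i ≤ M := fun i hi => Finset.le_sup hi
  set r : ℝ := (1 / 2) ^ M with hr
  have hr0 : 0 < r := by positivity
  set I : Finset (Σ _ : ℕ, ℕ) := J.sigma fun i => fiberCodes Z Set.univ (l i) with hI
  set m : (Σ _ : ℕ, ℕ) → ℕ := fun j => l j.1 with hm
  set ctr : (Σ _ : ℕ, ℕ) → AddCircle (1 : ℝ) :=
    fun j => c j.1 - ((j.2 / 2 ^ l j.1 : ℝ) : AddCircle (1 : ℝ)) with hctr
  set D : (Σ _ : ℕ, ℕ) → Set (AddCircle (1 : ℝ)) :=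
    fun j => Metric.ball (ctr j) (3 * (1 / 2) ^ m j) with hD
  have hDm : ∀ j, MeasurableSet (D j) := fun j => measurableSet_ball
  set φ : AddCircle (1 : ℝ) → ℝ :=
    fun x => ∑ j ∈ I, (D j).indicator (fun _ => (2 : ℝ) ^ (-(t * m j))) x with hφ
  set B : Set (AddCircle (1 : ℝ)) := {x | 1 ≤ φ x} with hB
  have hφm : Measurable φ :=
    Finset.measurable_sum _ fun j _ => measurable_const.indicator (hDm j)
  have hBm : MeasurableSet B := measurableSet_le measurable_const hφm
  have hint : ∀ j ∈ I, Integrable ((D j).indicator (fun _ => (2 : ℝ) ^ (-(t * m j)))) μ :=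
    fun j _ => (integrable_const _).indicator (hDm j)
  have hφint : ∫ x, φ x ∂μ ≤ 6 * C * ε := by
    have e1 : ∫ x, φ x ∂μ = ∑ j ∈ I, μ.real (D j) * (2 : ℝ) ^ (-(t * m j)) := by
      simp only [hφ]
      rw [integral_finsetSum _ hint]
      refine Finset.sum_congr rfl fun j _ => ?_
      rw [integral_indicator (hDm j)]
      simp
    rw [e1]
    calc _ ≤ ∑ j ∈ I, 2 * (3 * (1 / 2) ^ m j) * (2 : ℝ) ^ (-(t * m j)) := by
          gcongr with j
          exact volume_real_ball_addCircle_le _ (by positivity)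
      _ = ∑ i ∈ J, ((fiberCodes Z Set.univ (l i)).card : ℝ) *
            (2 * (3 * (1 / 2) ^ l i) * (2 : ℝ) ^ (-(t * l i))) := by
          rw [hI, Finset.sum_sigma]
          simp [hm]
      _ ≤ ∑ i ∈ J, C * (2 : ℝ) ^ (u * l i) *
            (2 * (3 * (1 / 2) ^ l i) * (2 : ℝ) ^ (-(t * l i))) := by
          gcongr with i
          exact h (l i)
      _ = ∑ i ∈ J, 6 * C * (2 : ℝ) ^ (-((s : ℝ) * l i)) := by
          refine Finset.sum_congr rfl fun i _ => ?_
          have e2 : ((1 / 2 : ℝ)) ^ l i = (2 : ℝ) ^ (-(l i : ℝ)) := by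
            rw [Real.rpow_neg two_pos.le, Real.rpow_natCast, one_div, inv_pow]
          have e3 : -((s : ℝ) * l i) = u * l i + -(l i : ℝ) + -(t * l i) := by
            rw [ht]; ring
          rw [e2, e3, Real.rpow_add two_pos, Real.rpow_add two_pos]
          ring
      _ ≤ 6 * C * ε := by
          rw [← Finset.mul_sum]
          gcongr
  have hBle : μ.real B ≤ (1 - s) / 4 := by
    have := mul_meas_ge_le_integral_of_nonneg (μ := μ) (f := φ)
      (Filter.Eventually.of_forall fun x => Finset.sum_nonneg fun j _ =>
        Set.indicator_nonneg (fun _ _ => by positivity) x) (integrable_finsetSum _ hint) 1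
    rw [one_mul] at this
    exact this.trans (hφint.trans hεC)
  have hrec := le_of_visit_recursion (α : AddCircle (1 : ℝ)) B
    (fun x n => ((fiberCodes Z (Metric.ball x r) n).card : ℝ))
    (fun x => I.filter fun j => x ∈ D j) m M t (by linarith)
    (fun x n => by exact_mod_cast card_fiberCodes_le n)
    (fun x n => by exact_mod_cast card_fiberCodes_ball_succ_le hZ x r n)
    (fun x j hj => by
      have := (Finset.mem_sigma.1 (Finset.mem_filter.1 hj).1).1
      exact ⟨hl1 _ this, hlM _ this⟩)
    (fun x _ n hn => by
      have := card_fiberCodes_ball_le_sum (n := n) (r := r) (x := x) hZ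
        (G := I.filter fun j => x ∈ D j) (m := m) (w := fun j => j.2)
        (fun j hj => (hlM _ (Finset.mem_sigma.1 (Finset.mem_filter.1 hj).1).1).trans hn)
        (fun p hp hpx => by
          obtain ⟨i, hi, hpi⟩ := Set.mem_iUnion₂.1 (hJ (Set.mem_image_of_mem _ hp))
          refine ⟨⟨i, dyadicCode (l i) p.2⟩, Finset.mem_filter.2 ⟨Finset.mem_sigma.2
            ⟨hi, mem_fiberCodes.2 ⟨p, hp, Set.mem_univ _, rfl⟩⟩, ?_⟩, rfl⟩
          have d1 : dist p.1 x < r := hpx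
          have d2 : dist (p.1 + p.2) (c i) < (1 / 2) ^ l i := hpi
          have d3 := dist_dyadicCode_le (l i) p.2
          have d4 : r ≤ (1 / 2) ^ l i :=
            pow_le_pow_of_le_one (by norm_num) (by norm_num) (hlM i hi)
          simp only [hD, hctr, hm, Metric.mem_ball]
          generalize ((dyadicCode (l i) p.2 / 2 ^ l i : ℝ) : AddCircle (1 : ℝ)) = q at *
          rw [dist_comm, dist_eq_norm] at d1
          rw [dist_eq_norm] at d2 d3 ⊢
          have e : x - (c i - q) = (x - p.1) + (p.1 + p.2 - c i) - (p.2 - q) := by abel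
          rw [e]
          have := norm_sub_le ((x - p.1) + (p.1 + p.2 - c i)) (p.2 - q)
          have := norm_add_le (x - p.1) (p.1 + p.2 - c i)
          linarith)
      exact_mod_cast this)
    (fun x hx => by
      have hlt : φ x < 1 := not_le.1 hx
      rw [Finset.sum_filter]
      refine le_trans (le_of_eq (Finset.sum_congr rfl fun j _ => ?_)) hlt.le
      rw [Set.indicator_apply])
  obtain ⟨K, hK⟩ := exists_forall_exists_dist_add_nsmul_lt hα hr0
  refine ⟨(K + 1) * 2 ^ K * 4 ^ M, by positivity, fun n => ?_⟩
  obtain ⟨x, hx⟩ := exists_sum_indicator_le (α : AddCircle (1 : ℝ)) hBm n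
  have hcard : ((fiberCodes Z Set.univ n).card : ℝ)
      ≤ (K + 1) * 2 ^ K * (fiberCodes Z (Metric.ball x r) n).card := by
    exact_mod_cast card_fiberCodes_univ_le hZ (fun z => hK z x) n
  refine hcard.trans ?_
  rw [mul_assoc ((K + 1 : ℝ) * 2 ^ K)]
  refine mul_le_mul_of_nonneg_left ((hrec n x).trans ?_) (by positivity)
  refine mul_le_mul_of_nonneg_left
    (Real.rpow_le_rpow_of_exponent_le one_le_two ?_) (by positivity)
  have : (n : ℝ) * μ.real B ≤ n * ((1 - s) / 4) := by gcongr
  rw [ht]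
  linarith

/-- Let `α` be irrational and `Z ⊆ 𝕋²` a nonempty closed set invariant under
`S(x, y) = (x + α, 2y)`. Then `{x + y : (x, y) ∈ Z}` has Hausdorff dimension `1`. -/
theorem dimH_sum_of_invariant_set (α : ℝ) (hα : Irrational α)
    (Z : Set (AddCircle (1 : ℝ) × AddCircle (1 : ℝ))) (hZne : Z.Nonempty) (hZcl : IsClosed Z)
    (hZinv : (fun p : AddCircle (1 : ℝ) × AddCircle (1 : ℝ) =>
        (p.1 + (α : AddCircle (1 : ℝ)), (2 : ℤ) • p.2)) '' Z ⊆ Z) :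
    dimH ((fun p : AddCircle (1 : ℝ) × AddCircle (1 : ℝ) => p.1 + p.2) '' Z) = 1 := by
  refine le_antisymm (dimH_addCircle_le _) (le_of_not_gt fun hlt => ?_)
  have hZ : ∀ p ∈ Z, ∀ k : ℕ,
      (p.1 + k • (α : AddCircle (1 : ℝ)), (2 ^ k : ℕ) • p.2) ∈ Z := by
    intro p hp k
    induction k with
    | zero => simpa using hp
    | succ k ih =>
      convert hZinv (Set.mem_image_of_mem _ ih) using 2
      · rw [succ_nsmul, add_assoc]
      · rw [pow_succ', mul_smul, ← natCast_zsmul _ 2]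
        rfl
  obtain ⟨s, hs, hs1⟩ := ENNReal.lt_iff_exists_nnreal_btwn.1 hlt
  have hs1 : s < 1 := by exact_mod_cast hs1
  have hs1' : (s : ℝ) < 1 := by exact_mod_cast hs1
  set U : Set ℝ := {u | 0 ≤ u ∧ ∃ C > 0, ∀ n : ℕ,
    ((fiberCodes Z Set.univ n).card : ℝ) ≤ C * 2 ^ (u * n)} with hU
  have hbdd : BddBelow U := ⟨0, fun u hu => hu.1⟩
  have hne : U.Nonempty := by
    refine ⟨1, zero_le_one, 1, one_pos, fun n => ?_⟩
    rw [one_mul, one_mul, Real.rpow_natCast]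
    exact_mod_cast card_fiberCodes_le n
  obtain ⟨u, hu, hult⟩ := exists_lt_of_csInf_lt hne
    (lt_add_of_pos_right (sInf U) (by linarith : 0 < (1 - (s : ℝ)) / 2))
  obtain ⟨hu0, C, hC, hCn⟩ := hu
  obtain ⟨C', hC', hCn'⟩ := exists_card_fiberCodes_le_of_dimH_lt hα hZcl hZ hs1 hs hu0 hC hCn
  have hnonneg : 0 ≤ u - (1 - s) / 2 := by
    by_contra! hneg
    have hlim : Filter.Tendsto (fun n : ℕ => C' * ((2 : ℝ) ^ (u - (1 - (s : ℝ)) / 2)) ^ n)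
        Filter.atTop (nhds (C' * 0)) :=
      (tendsto_pow_atTop_nhds_zero_of_lt_one (by positivity)
        (Real.rpow_lt_one_of_one_lt_of_neg one_lt_two hneg)).const_mul C'
    rw [mul_zero] at hlim
    obtain ⟨n, hn⟩ := (hlim.eventually (gt_mem_nhds one_pos)).exists
    obtain ⟨p, hp⟩ := hZne
    have h1 : 1 ≤ (fiberCodes Z Set.univ n).card :=
      Finset.card_pos.2 ⟨_, mem_fiberCodes.2 ⟨p, hp, Set.mem_univ _, rfl⟩⟩
    have h1' : (1 : ℝ) ≤ (fiberCodes Z Set.univ n).card := by exact_mod_cast h1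
    have h2 := hCn' n
    rw [Real.rpow_mul two_pos.le, Real.rpow_natCast] at h2
    linarith
  have := csInf_le hbdd (show u - (1 - s) / 2 ∈ U from ⟨hnonneg, C', hC', hCn'⟩)
  linarith
end

section
/- Let α be an irrational real number with 0 < α < 1 and let k ≥ 1 be an integer. Let Z ⊆ 𝕋^{k+1} (where 𝕋 = ℝ/ℤ) be a non-empty closed set invariant under the map S(x₁, …, x_k, y) = (x₁ + α, x₂ + x₁, x₃ + x₂, …, x_k + x_{k−1}, 2y) (all coordinates taken mod 1). Then the set {x_k + y mod 1 : (x₁, …, x_k, y) ∈ Z} ⊆ 𝕋 has Hausdorff dimension equal to 1. -/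
open MeasureTheory

/-- `PolySeq a d f` says that the `d`-th forward difference of `f` is constantly `a`. -/
def PolySeq {G : Type*} [AddCommGroup G] (a : G) : ℕ → (ℕ → G) → Prop
  | 0, f => ∀ n, f n = a
  | d + 1, f => PolySeq a d fun n => f (n + 1) - f n

namespace PolySeq

variable {G : Type*} [AddCommGroup G] {a b : G} {d : ℕ} {f g : ℕ → G}

lemma add (hf : PolySeq a d f) (hg : PolySeq b d g) :
    PolySeq (a + b) d fun n => f n + g n := by
  induction d generalizing f g with
  | zero => intro n; exact congrArg₂ (· + ·) (hf n) (hg n)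
  | succ d ih =>
    have := ih hf hg
    simp only [PolySeq]
    convert this using 2
    abel

lemma zsmul (m : ℤ) (hf : PolySeq a d f) : PolySeq (m • a) d fun n => m • f n := by
  induction d generalizing f with
  | zero => intro n; exact congrArg (m • ·) (hf n)
  | succ d ih =>
    have := ih hf
    simp only [PolySeq]
    convert this using 2
    rw [smul_sub]

lemma shift (h : ℕ) (hf : PolySeq a d f) : PolySeq a d fun n => f (n + h) := by
  induction d generalizing f with
  | zero => intro n; exact hf _
  | succ d ih =>
    have := ih hf
    simp only [PolySeq]
    convert this using 3
    congr 1
    ring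

lemma zero : PolySeq (0 : G) d fun _ => 0 := by
  induction d with
  | zero => intro n; rfl
  | succ d ih => simpa [PolySeq] using ih

lemma shift_sub (h : ℕ) (hf : PolySeq a (d + 1) f) :
    PolySeq ((h : ℤ) • a) d fun n => f (n + h) - f n := by
  induction h with
  | zero => simpa using zero
  | succ h ih =>
    have h1 : PolySeq a d fun n => f (n + h + 1) - f (n + h) :=
      shift (f := fun n => f (n + 1) - f n) h hf
    convert h1.add ih using 2
    · push_cast; rw [add_smul, one_smul, add_comm]
    · rw [← add_assoc]; abel

lemma shift_sub_shift (h h' : ℕ) (hf : PolySeq a (d + 1) f) :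
    PolySeq (((h : ℤ) - h') • a) d fun n => f (n + h) - f (n + h') := by
  convert (hf.shift_sub h).add ((hf.shift_sub h').zsmul (-1)) using 2
  · rw [sub_smul, neg_one_smul, sub_eq_add_neg]
  · rw [neg_one_smul]; abel

end PolySeq

/-- A form of van der Corput's inequality for a sequence of complex numbers in the unit disc. -/
lemma norm_sum_le_of_correlations {u : ℕ → ℂ} (hu : ∀ n, ‖u n‖ ≤ 1) {H N : ℕ} (hH : 0 < H)
    {ε : ℝ} (hε : 0 ≤ ε)
    (hc : ∀ h < H, ∀ h' < H, h ≠ h' →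
      ‖∑ n ∈ Finset.range N, u (n + h) * starRingEnd ℂ (u (n + h'))‖ ≤ ε * N) :
    ‖∑ n ∈ Finset.range N, u n‖ ≤ 2 * H + N * √(1 / H + ε) := by
  have hH' : (0 : ℝ) < H := by exact_mod_cast hH
  set V : ℕ → ℂ := fun n => ∑ h ∈ Finset.range H, u (n + h) with hV
  have hshift : ∀ h : ℕ, ‖∑ n ∈ Finset.range N, u n - ∑ n ∈ Finset.range N, u (n + h)‖ ≤ 2 * h := by
    intro h
    have e : ∑ n ∈ Finset.range N, u n - ∑ n ∈ Finset.range N, u (n + h)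
        = ∑ n ∈ Finset.range h, u n - ∑ n ∈ Finset.range h, u (N + n) := by
      have e1 := Finset.sum_range_add u N h
      have e2 := Finset.sum_range_add u h N
      rw [add_comm h N] at e2
      have e3 : ∑ n ∈ Finset.range N, u (n + h) = ∑ n ∈ Finset.range N, u (h + n) := by
        simp only [add_comm]
      rw [e3]
      linear_combination e2 - e1
    rw [e]
    have b1 : ‖∑ n ∈ Finset.range h, u n‖ ≤ h := by
      simpa using norm_sum_le_of_le (Finset.range h) (fun n _ => hu n)
    have b2 : ‖∑ n ∈ Finset.range h, u (N + n)‖ ≤ h := by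
      simpa using norm_sum_le_of_le (Finset.range h) (fun n _ => hu (N + n))
    linarith [norm_sub_le (∑ n ∈ Finset.range h, u n) (∑ n ∈ Finset.range h, u (N + n))]
  have hVsum : ∑ n ∈ Finset.range N, V n
      = ∑ h ∈ Finset.range H, ∑ n ∈ Finset.range N, u (n + h) := Finset.sum_comm
  have hdiff : ‖H * ∑ n ∈ Finset.range N, u n - ∑ n ∈ Finset.range N, V n‖ ≤ H * (2 * H) := by
    have : (H : ℂ) * ∑ n ∈ Finset.range N, u n - ∑ n ∈ Finset.range N, V n =
        ∑ h ∈ Finset.range H,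
          (∑ n ∈ Finset.range N, u n - ∑ n ∈ Finset.range N, u (n + h)) := by
      rw [Finset.sum_sub_distrib, hVsum]; simp
    rw [this]
    have := norm_sum_le_of_le (Finset.range H)
      (f := fun h => ∑ n ∈ Finset.range N, u n - ∑ n ∈ Finset.range N, u (n + h))
      (n := fun _ => 2 * (H : ℝ)) (fun h hh => (hshift h).trans (by
        have : (h : ℝ) ≤ H := by exact_mod_cast (Finset.mem_range.1 hh).le
        linarith))
    simpa using this
  have hsq : ∑ n ∈ Finset.range N, ‖V n‖ ^ 2 ≤ N * (H + H ^ 2 * ε) := by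
    have e : ((∑ n ∈ Finset.range N, ‖V n‖ ^ 2 : ℝ) : ℂ) =
        ∑ h ∈ Finset.range H, ∑ h' ∈ Finset.range H,
          ∑ n ∈ Finset.range N, u (n + h) * starRingEnd ℂ (u (n + h')) := by
      push_cast
      have : ∀ n, ((‖V n‖ : ℂ)) ^ 2 = ∑ h ∈ Finset.range H, ∑ h' ∈ Finset.range H,
          u (n + h) * starRingEnd ℂ (u (n + h')) := by
        intro n
        rw [← Complex.mul_conj', hV, map_sum, Finset.sum_mul_sum]
      simp_rw [this]
      rw [Finset.sum_comm]
      exact Finset.sum_congr rfl fun h _ => Finset.sum_comm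
    have e2 : ∑ n ∈ Finset.range N, ‖V n‖ ^ 2 = ‖((∑ n ∈ Finset.range N, ‖V n‖ ^ 2 : ℝ) : ℂ)‖ := by
      rw [Complex.norm_real, Real.norm_of_nonneg (by positivity)]
    rw [e2, e]
    have hb : ∀ h ∈ Finset.range H, ‖∑ h' ∈ Finset.range H,
          ∑ n ∈ Finset.range N, u (n + h) * starRingEnd ℂ (u (n + h'))‖ ≤ N + H * (ε * N) := by
      intro h hh
      have : ∀ h' ∈ Finset.range H,
          ‖∑ n ∈ Finset.range N, u (n + h) * starRingEnd ℂ (u (n + h'))‖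
            ≤ (if h = h' then (N : ℝ) else 0) + ε * N := by
        intro h' hh'
        split_ifs with hq
        · have : ‖∑ n ∈ Finset.range N, u (n + h) * starRingEnd ℂ (u (n + h'))‖ ≤ N := by
            have := norm_sum_le_of_le (Finset.range N)
              (f := fun n => u (n + h) * starRingEnd ℂ (u (n + h'))) (n := fun _ => (1 : ℝ))
              (fun n _ => by
                rw [norm_mul, RCLike.norm_conj]
                exact mul_le_one₀ (hu _) (norm_nonneg _) (hu _))
            simpa using this
          have : 0 ≤ ε * N := by positivity
          linarith
        · rw [zero_add]
          exact hc h (Finset.mem_range.1 hh) h' (Finset.mem_range.1 hh') hq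
      refine (norm_sum_le_of_le _ this).trans ?_
      rw [Finset.sum_add_distrib]
      simp [Finset.mem_range.1 hh]
    refine (norm_sum_le_of_le _ hb).trans ?_
    simp
    apply le_of_eq; ring
  have hcs : ‖∑ n ∈ Finset.range N, V n‖ ≤ N * (H * √(1 / H + ε)) := by
    have h1 : ‖∑ n ∈ Finset.range N, V n‖ ≤ ∑ n ∈ Finset.range N, ‖V n‖ := norm_sum_le _ _
    have h2 := sq_sum_le_card_mul_sum_sq (s := Finset.range N) (f := fun n => ‖V n‖)
    rw [Finset.card_range] at h2
    refine h1.trans (abs_le_of_sq_le_sq' ?_ (by positivity)).2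
    refine h2.trans ((mul_le_mul_of_nonneg_left hsq (by positivity)).trans (le_of_eq ?_))
    rw [mul_pow, mul_pow, Real.sq_sqrt (by positivity)]
    field_simp
  have : H * ‖∑ n ∈ Finset.range N, u n‖ ≤ H * (2 * H + N * √(1 / H + ε)) := by
    have h3 : ‖(H : ℂ) * ∑ n ∈ Finset.range N, u n‖ = H * ‖∑ n ∈ Finset.range N, u n‖ := by
      rw [norm_mul, Complex.norm_natCast]
    have h4 := norm_le_norm_sub_add ((H : ℂ) * ∑ n ∈ Finset.range N, u n)
      (∑ n ∈ Finset.range N, V n)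
    rw [h3] at h4
    nlinarith
  exact le_of_mul_le_mul_left this hH'

/-- Weyl's theorem, uniformly over all polynomial sequences with a given leading difference. -/
lemma PolySeq.norm_sum_toCircle_le (d : ℕ) {a : AddCircle (1 : ℝ)}
    (ha : ∀ m : ℤ, m ≠ 0 → m • a ≠ 0) {ε : ℝ} (hε : 0 < ε) :
    ∃ N₀ : ℕ, ∀ N ≥ N₀, ∀ f : ℕ → AddCircle (1 : ℝ), PolySeq a (d + 1) f →
      ‖∑ n ∈ Finset.range N, (AddCircle.toCircle (f n) : ℂ)‖ ≤ ε * N := by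
  induction d generalizing a ε with
  | zero =>
    set q : ℂ := ((AddCircle.toCircle a : Circle) : ℂ) with hq
    have hq1 : q ≠ 1 := by
      intro h
      have : AddCircle.toCircle a = AddCircle.toCircle (0 : AddCircle (1 : ℝ)) := by
        rw [AddCircle.toCircle_zero]; exact Circle.ext (by rw [← hq, h, Circle.coe_one])
      exact ha 1 one_ne_zero (by simpa using AddCircle.injective_toCircle one_ne_zero this)
    have hqn : ‖q‖ = 1 := Circle.norm_coe _
    have hpos : 0 < ‖q - 1‖ := norm_pos_iff.2 (sub_ne_zero.2 hq1)
    obtain ⟨N₀, hN₀⟩ := exists_nat_ge (2 / ‖q - 1‖ / ε)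
    refine ⟨N₀, fun N hN f hf => ?_⟩
    have hfn : ∀ n, (AddCircle.toCircle (f n) : ℂ) = AddCircle.toCircle (f 0) * q ^ n := by
      intro n
      induction n with
      | zero => simp
      | succ n ih =>
        have hn : f (n + 1) - f n = a := hf n
        have : f (n + 1) = f n + a := by rw [← hn, add_sub_cancel]
        rw [this, AddCircle.toCircle_add, Circle.coe_mul, ih, pow_succ, mul_assoc]
    rw [Finset.sum_congr rfl fun n _ => hfn n, ← Finset.mul_sum, norm_mul, Circle.norm_coe, one_mul,
      geom_sum_eq hq1, norm_div]
    have h2 : ‖q ^ N - 1‖ ≤ 2 := by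
      refine (norm_sub_le _ _).trans ?_
      rw [norm_pow, hqn]; norm_num
    have : 2 / ‖q - 1‖ ≤ ε * N := by
      rw [div_le_iff₀ hε] at hN₀
      have : (N₀ : ℝ) ≤ N := by exact_mod_cast hN
      nlinarith
    exact (div_le_div_of_nonneg_right h2 hpos.le).trans this
  | succ d ih =>
    obtain ⟨H, hH⟩ := exists_nat_gt (8 / ε ^ 2)
    have hH0 : (0 : ℝ) < H := lt_trans (by positivity) hH
    have hε' : 0 < ε ^ 2 / 8 := by positivity
    have key : ∀ h h' : ℕ, ∃ N₀ : ℕ, h ≠ h' → ∀ N ≥ N₀, ∀ f : ℕ → AddCircle (1 : ℝ),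
        PolySeq (((h : ℤ) - h') • a) (d + 1) f →
        ‖∑ n ∈ Finset.range N, (AddCircle.toCircle (f n) : ℂ)‖ ≤ ε ^ 2 / 8 * N := by
      intro h h'
      by_cases hh : h = h'
      · exact ⟨0, fun h => absurd hh h⟩
      · obtain ⟨N₀, hN₀⟩ := ih (a := ((h : ℤ) - h') • a) (fun m hm => by
          rw [smul_smul]
          refine ha _ (mul_ne_zero hm (sub_ne_zero.2 (by exact_mod_cast hh)))) hε'
        exact ⟨N₀, fun _ => hN₀⟩
    choose M hM using key
    obtain ⟨N₁, hN₁⟩ := exists_nat_ge (4 * H / ε)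
    refine ⟨max N₁ ((Finset.range H ×ˢ Finset.range H).sup fun p => M p.1 p.2),
      fun N hN f hf => ?_⟩
    have hcor := norm_sum_le_of_correlations
      (u := fun n => (AddCircle.toCircle (f n) : ℂ)) (H := H) (N := N) (ε := ε ^ 2 / 8)
      (fun n => (Circle.norm_coe _).le) (by exact_mod_cast hH0) hε'.le (by
        intro h hh h' hh' hne
        have hle : M h h' ≤ N := by
          refine le_trans ?_ ((le_max_right _ _).trans hN)
          exact Finset.le_sup (f := fun p : ℕ × ℕ => M p.1 p.2) (b := (h, h'))
            (by simp [hh, hh'])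
        have := hM h h' hne N hle _ (hf.shift_sub_shift h h')
        simpa only [sub_eq_add_neg, AddCircle.toCircle_add, AddCircle.toCircle_neg,
          Circle.coe_mul, Circle.coe_inv_eq_conj] using this)
    refine hcor.trans ?_
    have hs : √(1 / H + ε ^ 2 / 8) ≤ ε / 2 := by
      rw [Real.sqrt_le_left (by positivity)]
      have : 1 / (H : ℝ) ≤ ε ^ 2 / 8 := by
        rw [div_le_iff₀ hH0]
        rw [div_lt_iff₀ (by positivity)] at hH
        linarith
      nlinarith
    have hN1 : (N₁ : ℝ) ≤ N := by exact_mod_cast (le_max_left _ _).trans hN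
    rw [div_le_iff₀ hε] at hN₁
    have : (N : ℝ) * √(1 / H + ε ^ 2 / 8) ≤ N * (ε / 2) := by gcongr
    nlinarith

lemma integral_fourier_of_ne_zero {m : ℤ} (hm : m ≠ 0) :
    ∫ x : AddCircle (1 : ℝ), fourier m x = 0 := by
  have h := congrFun (fourierCoeff_fourier (T := 1) m) 0
  rw [Pi.single_apply, if_neg hm.symm, fourierCoeff] at h
  have hv : (volume : Measure (AddCircle (1 : ℝ))) = AddCircle.haarAddCircle := by
    rw [AddCircle.volume_eq_smul_haarAddCircle]; simp
  rw [hv]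
  simpa only [neg_zero, fourier_zero, one_smul] using h

/-- Weyl equidistribution, uniformly over all polynomial sequences with a given leading
difference. -/
lemma PolySeq.norm_sum_sub_integral_le (d : ℕ) {a : AddCircle (1 : ℝ)}
    (ha : ∀ m : ℤ, m ≠ 0 → m • a ≠ 0) (g : C(AddCircle (1 : ℝ), ℂ)) {ε : ℝ} (hε : 0 < ε) :
    ∃ N₀ : ℕ, ∀ N ≥ N₀, ∀ f : ℕ → AddCircle (1 : ℝ), PolySeq a (d + 1) f →
      ‖∑ n ∈ Finset.range N, g (f n) - N * ∫ x, g x‖ ≤ ε * N := by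
  have hint : ∀ g : C(AddCircle (1 : ℝ), ℂ), Integrable g := fun g =>
    g.continuous.integrable_of_hasCompactSupport (HasCompactSupport.of_compactSpace _)
  have hg : g ∈ (Submodule.span ℂ (Set.range (fourier (T := 1)))).topologicalClosure := by
    rw [span_fourier_closure_eq_top]; trivial
  rw [← SetLike.mem_coe, Submodule.topologicalClosure_coe, Metric.mem_closure_iff] at hg
  obtain ⟨p, hp, hgp⟩ := hg (ε / 4) (by positivity)
  have hspan : ∀ p ∈ Submodule.span ℂ (Set.range (fourier (T := 1))), ∀ ε > 0,
      ∃ N₀ : ℕ, ∀ N ≥ N₀, ∀ f : ℕ → AddCircle (1 : ℝ), PolySeq a (d + 1) f →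
      ‖∑ n ∈ Finset.range N, p (f n) - N * ∫ x, p x‖ ≤ ε * N := by
    intro p hp
    induction hp using Submodule.span_induction with
    | mem p hp =>
      obtain ⟨m, rfl⟩ := hp
      intro ε hε
      by_cases hm : m = 0
      · subst hm
        refine ⟨0, fun N _ f _ => ?_⟩
        have : (0 : ℝ) ≤ ε * N := by positivity
        simpa [measureReal_def, AddCircle.measure_univ] using this
      · obtain ⟨N₀, hN₀⟩ := PolySeq.norm_sum_toCircle_le d (a := m • a) (fun l hl => by
          rw [smul_smul]; exact ha _ (mul_ne_zero hl hm)) hε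
        refine ⟨N₀, fun N hN f hf => ?_⟩
        rw [integral_fourier_of_ne_zero hm, mul_zero, sub_zero]
        simpa only [fourier_apply] using hN₀ N hN _ (hf.zsmul m)
    | zero =>
      intro ε hε
      refine ⟨0, fun N _ f _ => ?_⟩
      simp; positivity
    | add p q _ _ hp hq =>
      intro ε hε
      obtain ⟨N₁, h1⟩ := hp (ε / 2) (by positivity)
      obtain ⟨N₂, h2⟩ := hq (ε / 2) (by positivity)
      refine ⟨max N₁ N₂, fun N hN f hf => ?_⟩
      have e : ∑ n ∈ Finset.range N, (p + q) (f n) - N * ∫ x, (p + q) x =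
          (∑ n ∈ Finset.range N, p (f n) - N * ∫ x, p x) +
          (∑ n ∈ Finset.range N, q (f n) - N * ∫ x, q x) := by
        simp only [ContinuousMap.add_apply]
        rw [Finset.sum_add_distrib, integral_add (hint p) (hint q)]
        ring
      rw [e]
      refine (norm_add_le _ _).trans ?_
      linarith [h1 N (le_of_max_le_left hN) f hf, h2 N (le_of_max_le_right hN) f hf]
    | smul c p _ hp =>
      intro ε hε
      obtain ⟨N₁, h1⟩ := hp (ε / (‖c‖ + 1)) (by positivity)
      refine ⟨N₁, fun N hN f hf => ?_⟩
      have e : ∑ n ∈ Finset.range N, (c • p) (f n) - N * ∫ x, (c • p) x =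
          c * (∑ n ∈ Finset.range N, p (f n) - N * ∫ x, p x) := by
        simp only [ContinuousMap.smul_apply, smul_eq_mul]
        rw [← Finset.mul_sum, integral_const_mul]
        ring
      rw [e, norm_mul]
      have := h1 N hN f hf
      calc _ ≤ ‖c‖ * (ε / (‖c‖ + 1) * N) := by gcongr
        _ = ‖c‖ / (‖c‖ + 1) * (ε * N) := by ring
        _ ≤ 1 * (ε * N) := by
          gcongr
          rw [div_le_one (by positivity)]; linarith
        _ = ε * N := one_mul _
  obtain ⟨N₀, hN₀⟩ := hspan p hp (ε / 4) (by positivity)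
  refine ⟨N₀, fun N hN f hf => ?_⟩
  have hpt : ∀ x, ‖g x - p x‖ ≤ ε / 4 := fun x => by
    rw [← dist_eq_norm]; exact (ContinuousMap.dist_apply_le_dist x).trans hgp.le
  have e : ∑ n ∈ Finset.range N, g (f n) - N * ∫ x, g x =
      ∑ n ∈ Finset.range N, (g (f n) - p (f n)) - N * (∫ x, (g x - p x)) +
      (∑ n ∈ Finset.range N, p (f n) - N * ∫ x, p x) := by
    rw [Finset.sum_sub_distrib, integral_sub (hint g) (hint p)]
    ring
  have h1 : ‖∑ n ∈ Finset.range N, (g (f n) - p (f n))‖ ≤ N * (ε / 4) := by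
    simpa using norm_sum_le_of_le (Finset.range N) (fun n _ => hpt (f n))
  have h2 : ‖∫ x, (g x - p x)‖ ≤ ε / 4 := by
    simpa [measureReal_def, AddCircle.measure_univ] using norm_integral_le_of_norm_le_const
      (μ := (volume : Measure (AddCircle (1 : ℝ))))
      (Filter.Eventually.of_forall hpt)
  have h3 : ‖(N : ℂ) * ∫ x, (g x - p x)‖ ≤ N * (ε / 4) := by
    rw [norm_mul, Complex.norm_natCast]; gcongr
  rw [e]
  refine (norm_add_le _ _).trans ?_
  have := norm_sub_le (∑ n ∈ Finset.range N, (g (f n) - p (f n))) ((N : ℂ) * ∫ x, (g x - p x))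
  have h4 : 0 ≤ ε * N := by positivity
  linarith [hN₀ N hN f hf]

/-- Upper bound for Birkhoff sums of a real continuous function along polynomial sequences. -/
lemma PolySeq.sum_le_of_integral_le (d : ℕ) {a : AddCircle (1 : ℝ)}
    (ha : ∀ m : ℤ, m ≠ 0 → m • a ≠ 0) {c : AddCircle (1 : ℝ) → ℝ} (hc : Continuous c) {κ : ℝ}
    (hκ : 0 < κ) (hcκ : ∫ x, c x ≤ κ) :
    ∃ N₀ : ℕ, ∀ N ≥ N₀, ∀ f : ℕ → AddCircle (1 : ℝ), PolySeq a (d + 1) f →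
      ∑ n ∈ Finset.range N, c (f n) ≤ 2 * κ * N := by
  obtain ⟨N₀, hN₀⟩ := PolySeq.norm_sum_sub_integral_le d ha
    ⟨fun x => (c x : ℂ), Complex.continuous_ofReal.comp hc⟩ hκ
  refine ⟨N₀, fun N hN f hf => ?_⟩
  have := hN₀ N hN f hf
  simp only [ContinuousMap.coe_mk] at this
  have hi : ∫ x, (c x : ℂ) = ((∫ x, c x : ℝ) : ℂ) := integral_ofReal
  rw [hi] at this
  have e : ∑ n ∈ Finset.range N, (c (f n) : ℂ) - N * ((∫ x, c x : ℝ) : ℂ) =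
      ((∑ n ∈ Finset.range N, c (f n) - N * ∫ x, c x : ℝ) : ℂ) := by push_cast; rfl
  rw [e, Complex.norm_real, Real.norm_eq_abs] at this
  have h2 : (N : ℝ) * ∫ x, c x ≤ N * κ := by gcongr
  linarith [(abs_le.1 this).2]

/-- A compact set of vanishing `s`-dimensional Hausdorff measure has a finite cover by balls of
small dyadic radii with small `s`-sum. -/
lemma IsCompact.exists_dyadic_cover_of_hausdorffMeasure_eq_zero {X : Type*} [MetricSpace X]
    [Nonempty X] [MeasurableSpace X] [BorelSpace X] {F : Set X} (hF : IsCompact F) {s : ℝ}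
    (hs0 : 0 < s) (hs1 : s ≤ 1) (hμ : μH[s] F = 0) {η : ℝ} (hη : 0 < η) (M : ℕ) :
    ∃ (J : Finset ℕ) (u : ℕ → X) (m : ℕ → ℕ), (∀ i, M ≤ m i) ∧
      (F ⊆ ⋃ i ∈ J, Metric.ball (u i) ((1 / 2) ^ m i)) ∧
      ∑ i ∈ J, (((1 / 2 : ℝ) ^ m i) ^ s) ≤ η := by
  set r : ℝ := (1 / 2) ^ (M + 1)
  have hr0 : 0 < r := by positivity
  rw [Measure.hausdorffMeasure_apply] at hμ
  simp only [ENNReal.iSup_eq_zero] at hμ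
  have h1 := hμ (ENNReal.ofReal r) (by simpa using hr0)
  have h2 : (0 : ENNReal) < ENNReal.ofReal (η / 8) := by simpa using hη
  rw [← h1] at h2
  simp only [iInf_lt_iff] at h2
  obtain ⟨t, hFt, htr, hsum⟩ := h2
  have hiSup : ∀ n, (⨆ (_ : (t n).Nonempty), Metric.ediam (t n) ^ s) = Metric.ediam (t n) ^ s := by
    intro n
    by_cases h : (t n).Nonempty
    · simp [h]
    · rw [Set.not_nonempty_iff_eq_empty] at h
      simp [h, hs0]
  simp only [hiSup] at hsum
  obtain ⟨δ, hδ0, hδ⟩ := posSumOfEncodable (ε := η / 8) (by positivity) ℕ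
  obtain ⟨c, hδc, hcη⟩ := hδ
  have htop : ∀ n, Metric.ediam (t n) ≠ ⊤ := fun n =>
    ne_top_of_le_ne_top ENNReal.ofReal_ne_top (htr n)
  have hdr : ∀ n, Metric.diam (t n) ≤ r := fun n => ENNReal.toReal_le_of_le_ofReal hr0.le (htr n)
  set d : ℕ → ℝ := fun n => max (Metric.diam (t n)) (min (δ n ^ (1 / s)) r)
  have hd0 : ∀ n, 0 < d n := fun n =>
    lt_max_of_lt_right (lt_min (Real.rpow_pos_of_pos (hδ0 n) _) hr0)
  have hdr' : ∀ n, d n ≤ r := fun n => max_le (hdr n) (min_le_right _ _)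
  have hr1 : r ≤ 1 := pow_le_one₀ (by norm_num) (by norm_num)
  have hm : ∀ n, ∃ m : ℕ, M ≤ m ∧ d n < (1 / 2) ^ m ∧ (1 / 2 : ℝ) ^ m < 4 * d n := by
    intro n
    obtain ⟨l, hl1, hl2⟩ := exists_nat_pow_near_of_lt_one (hd0 n) ((hdr' n).trans hr1)
      (y := (1 / 2 : ℝ)) (by norm_num) (by norm_num)
    have hMl : M + 1 < l + 1 := by
      by_contra hcon
      push Not at hcon
      have := pow_le_pow_of_le_one (a := (1 / 2 : ℝ)) (by norm_num) (by norm_num) hcon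
      linarith [hdr' n]
    obtain ⟨m, rfl⟩ : ∃ m, l = m + 1 := ⟨l - 1, by omega⟩
    refine ⟨m, by omega, ?_, ?_⟩
    · rw [pow_succ] at hl2
      have : (0 : ℝ) < (1 / 2) ^ m := by positivity
      linarith
    · rw [pow_succ, pow_succ] at hl1
      linarith
  choose m hmM hm1 hm2 using hm
  have hu : ∀ n, ∃ u : X, t n ⊆ Metric.ball u ((1 / 2) ^ m n) := by
    intro n
    by_cases h : (t n).Nonempty
    · obtain ⟨u, hu⟩ := h
      refine ⟨u, fun x hx => ?_⟩
      rw [Metric.mem_ball]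
      exact ((Metric.dist_le_diam_of_mem' (htop n) hx hu).trans (le_max_left _ _)).trans_lt (hm1 n)
    · rw [Set.not_nonempty_iff_eq_empty] at h
      exact ⟨Classical.arbitrary X, by simp [h]⟩
  choose u hu using hu
  obtain ⟨J, hJ⟩ := hF.elim_finite_subcover (fun n => Metric.ball (u n) ((1 / 2) ^ m n))
    (fun _ => Metric.isOpen_ball) (hFt.trans (Set.iUnion_mono hu))
  refine ⟨J, u, m, hmM, hJ, ?_⟩
  have hb : ∀ i ∈ J, (((1 / 2 : ℝ) ^ m i) ^ s) ≤ 4 * (Metric.diam (t i) ^ s + δ i) := by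
    intro i _
    have hdi : d i ^ s ≤ Metric.diam (t i) ^ s + δ i := by
      rcases le_total (Metric.diam (t i)) (min (δ i ^ (1 / s)) r) with h | h
      · have : d i ≤ δ i ^ (1 / s) := max_le (h.trans (min_le_left _ _)) (min_le_left _ _)
        have := Real.rpow_le_rpow (hd0 i).le this hs0.le
        rw [← Real.rpow_mul (hδ0 i).le, one_div_mul_cancel hs0.ne', Real.rpow_one] at this
        have h3 : 0 ≤ Metric.diam (t i) ^ s := Real.rpow_nonneg Metric.diam_nonneg _
        linarith
      · have : d i = Metric.diam (t i) := max_eq_left h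
        rw [this]
        linarith [hδ0 i]
    calc ((1 / 2 : ℝ) ^ m i) ^ s ≤ (4 * d i) ^ s :=
          Real.rpow_le_rpow (by positivity) (hm2 i).le hs0.le
      _ = 4 ^ s * d i ^ s := Real.mul_rpow (by norm_num) (hd0 i).le
      _ ≤ 4 ^ (1 : ℝ) * d i ^ s := by
          have := Real.rpow_nonneg (hd0 i).le s
          gcongr
          norm_num
      _ ≤ _ := by rw [Real.rpow_one]; gcongr
  refine (Finset.sum_le_sum hb).trans ?_
  rw [← Finset.mul_sum, Finset.sum_add_distrib]
  have hδs : ∑ i ∈ J, δ i ≤ η / 8 :=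
    (sum_le_hasSum J (fun i _ => (hδ0 i).le) hδc).trans hcη
  have hds : ∑ i ∈ J, Metric.diam (t i) ^ s ≤ η / 8 := by
    have h3 : ∑ i ∈ J, Metric.ediam (t i) ^ s ≤ ENNReal.ofReal (η / 8) :=
      (ENNReal.sum_le_tsum J).trans hsum.le
    have h4 := ENNReal.toReal_le_of_le_ofReal (by positivity) h3
    rw [ENNReal.toReal_sum (fun i _ => ENNReal.rpow_ne_top_of_nonneg hs0.le (htop i))] at h4
    simpa only [← ENNReal.toReal_rpow, Metric.diam] using h4
  linarith

lemma floor_mul_equivIco_lt {R : ℕ} (hR : 0 < R) (y : AddCircle (1 : ℝ)) :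
    ⌊(R : ℝ) * (AddCircle.equivIco (1 : ℝ) 0 y : ℝ)⌋₊ < R := by
  have h : (AddCircle.equivIco (1 : ℝ) 0 y : ℝ) ∈ Set.Ico (0 : ℝ) (0 + 1) :=
    (AddCircle.equivIco (1 : ℝ) 0 y).2
  have h1 := h.2.trans_eq (zero_add 1)
  have hR' : (0 : ℝ) < R := by exact_mod_cast hR
  rw [Nat.floor_lt (mul_nonneg hR'.le h.1)]
  nlinarith

lemma norm_sub_floor_mul_equivIco_le {R : ℕ} (hR : 0 < R) (y : AddCircle (1 : ℝ)) :
    ‖y - ((⌊(R : ℝ) * (AddCircle.equivIco (1 : ℝ) 0 y : ℝ)⌋₊ / R : ℝ) : AddCircle (1 : ℝ))‖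
      ≤ 1 / R := by
  have h : (AddCircle.equivIco (1 : ℝ) 0 y : ℝ) ∈ Set.Ico (0 : ℝ) (0 + 1) :=
    (AddCircle.equivIco (1 : ℝ) 0 y).2
  have hy : ((AddCircle.equivIco (1 : ℝ) 0 y : ℝ) : AddCircle (1 : ℝ)) = y :=
    AddCircle.coe_equivIco
  nth_rewrite 1 [← hy]
  rw [← AddCircle.coe_sub]
  refine (QuotientAddGroup.norm_mk_le_norm).trans ?_
  have hR' : (0 : ℝ) < R := by exact_mod_cast hR
  generalize (AddCircle.equivIco (1 : ℝ) 0 y : ℝ) = r at *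
  have h1 := Nat.floor_le (mul_nonneg hR'.le h.1)
  have h2 := Nat.lt_floor_add_one (R * r)
  have e : r - ⌊R * r⌋₊ / R = (R * r - ⌊R * r⌋₊) / R := by field_simp
  rw [Real.norm_eq_abs, e, abs_of_nonneg (div_nonneg (by linarith) hR'.le)]
  gcongr
  linarith

/-- The first `n` binary digits of a point of the circle, encoded as a natural number. -/
noncomputable def binaryWord (n : ℕ) (y : AddCircle (1 : ℝ)) : ℕ :=
  ⌊2 ^ n * (AddCircle.equivIco (1 : ℝ) 0 y : ℝ)⌋₊

lemma binaryWord_lt (n : ℕ) (y : AddCircle (1 : ℝ)) : binaryWord n y < 2 ^ n := by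
  simpa [binaryWord] using floor_mul_equivIco_lt (R := 2 ^ n) (by positivity) y

lemma norm_sub_binaryWord_le (n : ℕ) (y : AddCircle (1 : ℝ)) :
    ‖y - ((binaryWord n y / 2 ^ n : ℝ) : AddCircle (1 : ℝ))‖ ≤ (1 / 2) ^ n := by
  simpa [binaryWord] using norm_sub_floor_mul_equivIco_le (R := 2 ^ n) (by positivity) y

lemma binaryWord_add (m n : ℕ) (y : AddCircle (1 : ℝ)) :
    binaryWord (m + n) y = binaryWord m y * 2 ^ n + binaryWord n ((2 ^ m : ℕ) • y) := by
  set r : ℝ := (AddCircle.equivIco (1 : ℝ) 0 y : ℝ) with hr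
  have h : r ∈ Set.Ico (0 : ℝ) (0 + 1) := (AddCircle.equivIco (1 : ℝ) 0 y).2
  have hy : (r : AddCircle (1 : ℝ)) = y := AddCircle.coe_equivIco
  have hm : (AddCircle.equivIco (1 : ℝ) 0 ((2 ^ m : ℕ) • y) : ℝ) = Int.fract (2 ^ m * r) := by
    rw [← hy, ← AddCircle.coe_nsmul, nsmul_eq_mul]
    push_cast
    rw [AddCircle.coe_equivIco_mk_apply]
    simp
  have h0 : 0 ≤ 2 ^ m * r := mul_nonneg (by positivity) h.1
  rw [binaryWord, binaryWord, binaryWord, hm, ← hr, pow_add]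
  have e : (2 : ℝ) ^ m * 2 ^ n * r
      = 2 ^ n * Int.fract (2 ^ m * r) + ((⌊2 ^ m * r⌋₊ * 2 ^ n : ℕ) : ℝ) := by
    have := Int.self_sub_floor (2 ^ m * r)
    rw [← this, ← natCast_floor_eq_intCast_floor h0]
    push_cast
    ring
  rw [e, Nat.floor_add_natCast (mul_nonneg (by positivity) (Int.fract_nonneg _)), add_comm]

section Words

variable {X : Type*} (Z : Set (X × AddCircle (1 : ℝ))) (τ : X → X) (φ : X → AddCircle (1 : ℝ))

open Classical in
/-- The binary words of length `n` of second coordinates of points of `Z`. -/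
noncomputable def words (n : ℕ) : Finset ℕ :=
  {w ∈ Finset.range (2 ^ n) | ∃ p ∈ Z, binaryWord n p.2 = w}

open Classical in
/-- The binary words of length `n` of second coordinates of those points of `Z` whose first
coordinate has an orbit that is `δ`-close to `ξ` up to time `n`, as seen through `φ`. -/
noncomputable def fiberWords (δ : ℝ) (n : ℕ) (ξ : ℕ → AddCircle (1 : ℝ)) : Finset ℕ :=
  {w ∈ Finset.range (2 ^ n) |
    ∃ p ∈ Z, (∀ j < n, ‖φ (τ^[j] p.1) - ξ j‖ ≤ δ) ∧ binaryWord n p.2 = w}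

variable {Z τ φ}

lemma mem_words {n w : ℕ} : w ∈ words Z n ↔ ∃ p ∈ Z, binaryWord n p.2 = w := by
  simp only [words, Finset.mem_filter, Finset.mem_range, and_iff_right_iff_imp]
  rintro ⟨p, -, rfl⟩
  exact binaryWord_lt _ _

lemma mem_fiberWords {δ : ℝ} {n w : ℕ} {ξ : ℕ → AddCircle (1 : ℝ)} :
    w ∈ fiberWords Z τ φ δ n ξ ↔
      ∃ p ∈ Z, (∀ j < n, ‖φ (τ^[j] p.1) - ξ j‖ ≤ δ) ∧ binaryWord n p.2 = w := by
  simp only [fiberWords, Finset.mem_filter, Finset.mem_range, and_iff_right_iff_imp]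
  rintro ⟨p, -, -, rfl⟩
  exact binaryWord_lt _ _

lemma card_fiberWords_le_two_pow {δ : ℝ} {n : ℕ} {ξ : ℕ → AddCircle (1 : ℝ)} :
    (fiberWords Z τ φ δ n ξ).card ≤ 2 ^ n := by
  classical
  simpa [fiberWords] using Finset.card_filter_le (Finset.range (2 ^ n)) _

lemma iterate_mem (hZ : ∀ p ∈ Z, (τ p.1, 2 • p.2) ∈ Z) (n : ℕ) {p : X × AddCircle (1 : ℝ)}
    (hp : p ∈ Z) : (τ^[n] p.1, (2 ^ n : ℕ) • p.2) ∈ Z := by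
  induction n with
  | zero => simpa using hp
  | succ n ih =>
    have := hZ _ ih
    simp only [smul_smul] at this
    rwa [Function.iterate_succ_apply', pow_succ']

lemma card_words_pos (hne : Z.Nonempty) (n : ℕ) : 0 < (words Z n).card := by
  obtain ⟨p, hp⟩ := hne
  exact Finset.card_pos.2 ⟨_, mem_words.2 ⟨p, hp, rfl⟩⟩

lemma card_words_add_le (hZ : ∀ p ∈ Z, (τ p.1, 2 • p.2) ∈ Z) (m n : ℕ) :
    (words Z (m + n)).card ≤ (words Z m).card * (words Z n).card := by
  classical
  rw [← Finset.card_product]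
  refine (Finset.card_le_card ?_).trans
    (Finset.card_image_le (f := fun q : ℕ × ℕ => q.1 * 2 ^ n + q.2))
  intro w hw
  obtain ⟨p, hp, rfl⟩ := mem_words.1 hw
  rw [binaryWord_add]
  exact Finset.mem_image.2 ⟨(_, _), Finset.mem_product.2
    ⟨mem_words.2 ⟨p, hp, rfl⟩, mem_words.2 ⟨_, iterate_mem hZ m hp, rfl⟩⟩, rfl⟩

/-- If `Z` is covered by finitely many strips, the number of words over a given base orbit grows
at most like `θ ^ n` times the exponential of the Birkhoff sum of the weight function `c` that
counts the strips. -/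
lemma exists_card_fiberWords_le (hZ : ∀ p ∈ Z, (τ p.1, 2 • p.2) ∈ Z) {J : Finset ℕ}
    {u : ℕ → AddCircle (1 : ℝ)} {m : ℕ → ℕ} (hm : ∀ i, 1 ≤ m i)
    (hcov : ∀ p ∈ Z, ∃ i ∈ J, ‖φ p.1 + p.2 - u i‖ ≤ (1 / 2) ^ m i)
    {δ : ℝ} (hδ : ∀ i ∈ J, δ ≤ (1 / 2) ^ m i) {θ : ℝ} (hθ : 0 < θ)
    {c : AddCircle (1 : ℝ) → ℝ} (hc0 : ∀ x, 0 ≤ c x)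
    (hc : ∀ x, ∑ i ∈ J, ∑ w ∈ words Z (m i),
      (if ‖x - (u i - ((w / 2 ^ m i : ℝ) : AddCircle (1 : ℝ)))‖ ≤ 3 * (1 / 2) ^ m i
        then (θ ^ m i)⁻¹ else 0) ≤ c x) :
    ∃ K : ℝ, 0 < K ∧ ∀ n ξ, ((fiberWords Z τ φ δ n ξ).card : ℝ) ≤
      K * θ ^ n * Real.exp (∑ j ∈ Finset.range n, c (ξ j)) := by
  classical
  set M := J.sup m
  set K : ℝ := ∑ n ∈ Finset.range (M + 1), (2 / θ) ^ n
  have hK0 : 0 < K := Finset.sum_pos (fun n _ => by positivity) ⟨0, by simp⟩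
  refine ⟨K, hK0, fun n => ?_⟩
  induction n using Nat.strong_induction_on with
  | _ n ih =>
  intro ξ
  rcases le_or_gt n M with hn | hn
  · have h1 : ((fiberWords Z τ φ δ n ξ).card : ℝ) ≤ 2 ^ n := by
      exact_mod_cast card_fiberWords_le_two_pow
    have h2 : (2 / θ) ^ n ≤ K :=
      Finset.single_le_sum (f := fun n => (2 / θ) ^ n) (fun i _ => by positivity)
        (Finset.mem_range.2 (by omega))
    have h3 : 1 ≤ Real.exp (∑ j ∈ Finset.range n, c (ξ j)) :=
      Real.one_le_exp (Finset.sum_nonneg fun j _ => hc0 _)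
    have h4 : (2 : ℝ) ^ n ≤ K * θ ^ n := by
      rw [div_pow, div_le_iff₀ (by positivity)] at h2
      exact h2
    calc _ ≤ (2 : ℝ) ^ n := h1
      _ ≤ K * θ ^ n * 1 := by rwa [mul_one]
      _ ≤ _ := by gcongr
  · have hmn : ∀ i ∈ J, m i < n := fun i hi => (Finset.le_sup hi).trans_lt hn
    let good : (Σ _ : ℕ, ℕ) → Prop := fun q =>
      ‖ξ 0 - (u q.1 - ((q.2 / 2 ^ m q.1 : ℝ) : AddCircle (1 : ℝ)))‖ ≤ 3 * (1 / 2) ^ m q.1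
    have hsub : fiberWords Z τ φ δ n ξ ⊆
        ((J.sigma fun i => words Z (m i)).filter good).biUnion fun q =>
          (fiberWords Z τ φ δ (n - m q.1) fun j => ξ (j + m q.1)).image
            fun w => q.2 * 2 ^ (n - m q.1) + w := by
      intro w hw
      obtain ⟨p, hp, hpξ, rfl⟩ := mem_fiberWords.1 hw
      obtain ⟨i, hi, hpi⟩ := hcov p hp
      have hin := hmn i hi
      refine Finset.mem_biUnion.2 ⟨⟨i, binaryWord (m i) p.2⟩, ?_, ?_⟩
      · refine Finset.mem_filter.2
          ⟨Finset.mem_sigma.2 ⟨hi, mem_words.2 ⟨p, hp, rfl⟩⟩, ?_⟩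
        have h1 : ‖φ p.1 - ξ 0‖ ≤ (1 / 2) ^ m i := (hpξ 0 (by omega)).trans (hδ i hi)
        have h2 := norm_sub_binaryWord_le (m i) p.2
        simp only [good]
        set v := ((binaryWord (m i) p.2 / 2 ^ m i : ℝ) : AddCircle (1 : ℝ))
        have e : ξ 0 - (u i - v) = (φ p.1 + p.2 - u i) - (φ p.1 - ξ 0) - (p.2 - v) := by abel
        rw [e]
        have h3 := norm_sub_le (φ p.1 + p.2 - u i - (φ p.1 - ξ 0)) (p.2 - v)
        have h4 := norm_sub_le (φ p.1 + p.2 - u i) (φ p.1 - ξ 0)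
        linarith
      · refine Finset.mem_image.2 ⟨binaryWord (n - m i) ((2 ^ m i : ℕ) • p.2), ?_, ?_⟩
        · refine mem_fiberWords.2 ⟨_, iterate_mem hZ (m i) hp, fun j hj => ?_, rfl⟩
          rw [← Function.iterate_add_apply]
          dsimp only at hj ⊢
          exact hpξ _ (by omega)
        · rw [← binaryWord_add]
          dsimp only
          rw [Nat.add_sub_cancel' hin.le]
    set S := ∑ j ∈ Finset.range n, c (ξ j) with hS
    have hterm : ∀ i ∈ J, ((fiberWords Z τ φ δ (n - m i) fun j => ξ (j + m i)).card : ℝ) ≤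
        K * θ ^ n * Real.exp (S - c (ξ 0)) * (θ ^ m i)⁻¹ := by
      intro i hi
      have hin := hmn i hi
      have h1 := ih (n - m i) (by have := hm i; omega) fun j => ξ (j + m i)
      have h2 : ∑ j ∈ Finset.range (n - m i), c (ξ (j + m i)) ≤ S - c (ξ 0) := by
        have e := Finset.sum_range_add (fun j => c (ξ j)) (m i) (n - m i)
        rw [Nat.add_sub_cancel' hin.le] at e
        have h3 : c (ξ 0) ≤ ∑ j ∈ Finset.range (m i), c (ξ j) :=
          Finset.single_le_sum (f := fun j => c (ξ j)) (fun _ _ => hc0 _)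
            (Finset.mem_range.2 (hm i))
        simp only [add_comm _ (m i)]
        rw [hS, e]
        linarith
      have h4 : θ ^ (n - m i) = θ ^ n * (θ ^ m i)⁻¹ := by
        rw [eq_mul_inv_iff_mul_eq₀ (by positivity), ← pow_add, Nat.sub_add_cancel hin.le]
      calc _ ≤ _ := h1
        _ ≤ K * θ ^ (n - m i) * Real.exp (S - c (ξ 0)) := by gcongr
        _ = _ := by rw [h4]; ring
    have hcard : ((fiberWords Z τ φ δ n ξ).card : ℝ) ≤
        ∑ q ∈ (J.sigma fun i => words Z (m i)).filter good,
          K * θ ^ n * Real.exp (S - c (ξ 0)) * (θ ^ m q.1)⁻¹ := by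
      have h1 := (Finset.card_le_card hsub).trans Finset.card_biUnion_le
      refine (Nat.cast_le (α := ℝ).2 h1).trans ?_
      rw [Nat.cast_sum]
      refine Finset.sum_le_sum fun q hq => ?_
      have hqJ := (Finset.mem_sigma.1 (Finset.mem_filter.1 hq).1).1
      exact (Nat.cast_le.2 Finset.card_image_le).trans (hterm q.1 hqJ)
    rw [← Finset.mul_sum, Finset.sum_filter, Finset.sum_sigma] at hcard
    calc _ ≤ _ := hcard
      _ ≤ K * θ ^ n * Real.exp (S - c (ξ 0)) * c (ξ 0) := by
        gcongr
        exact hc (ξ 0)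
      _ ≤ K * θ ^ n * Real.exp (S - c (ξ 0)) * Real.exp (c (ξ 0)) := by
        gcongr
        linarith [Real.add_one_le_exp (c (ξ 0))]
      _ = K * θ ^ n * Real.exp S := by
        rw [mul_assoc, ← Real.exp_add, sub_add_cancel]

end Words

/-- A continuous bump that is at least `1` on the ball of radius `3 * r` around `p` and is supported
in the ball of radius `6 * r`. -/
noncomputable def circleBump (p : AddCircle (1 : ℝ)) (r : ℝ) (x : AddCircle (1 : ℝ)) : ℝ :=
  max 0 (2 - ‖x - p‖ / (3 * r))

lemma continuous_circleBump (p : AddCircle (1 : ℝ)) (r : ℝ) : Continuous (circleBump p r) := by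
  unfold circleBump
  fun_prop

lemma circleBump_nonneg (p : AddCircle (1 : ℝ)) (r : ℝ) (x : AddCircle (1 : ℝ)) :
    0 ≤ circleBump p r x := le_max_left _ _

lemma one_le_circleBump {p x : AddCircle (1 : ℝ)} {r : ℝ} (hr : 0 < r) (hx : ‖x - p‖ ≤ 3 * r) :
    1 ≤ circleBump p r x := by
  refine le_max_of_le_right ?_
  have : ‖x - p‖ / (3 * r) ≤ 1 := (div_le_one (by positivity)).2 hx
  linarith

lemma integral_circleBump_le (p : AddCircle (1 : ℝ)) {r : ℝ} (hr : 0 < r) :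
    ∫ x, circleBump p r x ≤ 24 * r := by
  have hle : ∀ x, circleBump p r x ≤ (Metric.closedBall p (6 * r)).indicator (fun _ => (2 : ℝ)) x := by
    intro x
    by_cases hx : x ∈ Metric.closedBall p (6 * r)
    · rw [Set.indicator_of_mem hx]
      refine max_le (by norm_num) ?_
      have : 0 ≤ ‖x - p‖ / (3 * r) := by positivity
      linarith
    · rw [Set.indicator_of_notMem hx]
      refine max_le le_rfl ?_
      rw [Metric.mem_closedBall, dist_eq_norm, not_le] at hx
      have : 2 ≤ ‖x - p‖ / (3 * r) := by
        rw [le_div_iff₀ (by positivity)]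
        linarith
      linarith
  refine (integral_mono ?_ ?_ hle).trans ?_
  · exact (continuous_circleBump p r).integrable_of_hasCompactSupport
      (HasCompactSupport.of_compactSpace _)
  · exact (integrable_const _).indicator Metric.isClosed_closedBall.measurableSet
  · rw [integral_indicator Metric.isClosed_closedBall.measurableSet, setIntegral_const, smul_eq_mul,
      measureReal_def, AddCircle.volume_closedBall, ENNReal.toReal_ofReal (by positivity)]
    have := min_le_right (1 : ℝ) (2 * (6 * r))
    linarith

lemma exists_poly_lt_exp (B : ℝ) (q N₀ : ℕ) {γ : ℝ} (hγ : 0 < γ) :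
    ∃ N ≥ N₀, B * ((N : ℝ) + 1) ^ q < Real.exp (γ * N) := by
  have h := tendsto_pow_const_div_const_pow_of_one_lt q (r := Real.exp γ) (Real.one_lt_exp_iff.2 hγ)
  have h2 := (Filter.tendsto_add_atTop_iff_nat 1).2 h
  have h3 := (h2.const_mul (B * Real.exp γ)).eventually_lt_const (u := 1) (by simp)
  obtain ⟨N, hN, hN₀⟩ := (h3.and (Filter.eventually_ge_atTop N₀)).exists
  refine ⟨N, hN₀, ?_⟩
  rw [pow_succ, ← mul_div_assoc, div_lt_one (by positivity)] at hN
  push_cast at hN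
  rw [mul_comm γ, Real.exp_nat_mul]
  have : 0 < Real.exp γ := Real.exp_pos _
  refine lt_of_mul_lt_mul_right ?_ this.le
  linarith

/-- Abstract form of the dimension bound: an extension of the doubling map by a base system that is
observed through polynomial sequences and whose orbits can be shadowed by polynomially many ones. -/
theorem one_le_dimH_of_invariant {X : Type*} {Z : Set (X × AddCircle (1 : ℝ))} {τ : X → X}
    {φ : X → AddCircle (1 : ℝ)} (hne : Z.Nonempty) (hZ : ∀ p ∈ Z, (τ p.1, 2 • p.2) ∈ Z)
    (hcomp : IsCompact ((fun p : X × AddCircle (1 : ℝ) => φ p.1 + p.2) '' Z))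
    {d : ℕ} {a : AddCircle (1 : ℝ)} (ha : ∀ m : ℤ, m ≠ 0 → m • a ≠ 0)
    (hpoly : ∀ x, PolySeq a (d + 1) fun j => φ (τ^[j] x))
    (hgrid : ∀ δ > 0, ∃ C q : ℕ, ∀ N : ℕ, ∃ G : Finset X, G.card ≤ C * (N + 1) ^ q ∧
      ∀ x, ∃ z ∈ G, ∀ j < N, ‖φ (τ^[j] x) - φ (τ^[j] z)‖ ≤ δ) :
    1 ≤ dimH ((fun p : X × AddCircle (1 : ℝ) => φ p.1 + p.2) '' Z) := by
  classical
  by_contra hlt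
  rw [not_le] at hlt
  obtain ⟨s, hs, hs1⟩ := ENNReal.lt_iff_exists_nnreal_btwn.1 hlt
  have hμ := hausdorffMeasure_of_dimH_lt hs
  have hs0 : (0 : ℝ) < s := by
    have : (0 : ENNReal) < s := lt_of_le_of_lt zero_le hs
    exact_mod_cast this
  replace hs1 : (s : ℝ) < 1 := by exact_mod_cast hs1
  -- the exponential growth rate of the number of words
  set l : ℕ → ℝ := fun n => Real.log (words Z n).card with hl
  have hlpos : ∀ n, (0 : ℝ) < (words Z n).card := fun n => by exact_mod_cast card_words_pos hne n
  have hl0 : ∀ n, 0 ≤ l n := fun n => Real.log_nonneg (by exact_mod_cast card_words_pos hne n)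
  have hsub : Subadditive l := by
    intro m n
    rw [hl]
    dsimp only
    rw [← Real.log_mul (hlpos m).ne' (hlpos n).ne']
    exact Real.log_le_log (hlpos _) (by exact_mod_cast card_words_add_le hZ m n)
  have hbdd : BddBelow (Set.range fun n => l n / n) := by
    refine ⟨0, ?_⟩
    rintro _ ⟨n, rfl⟩
    exact div_nonneg (hl0 n) (Nat.cast_nonneg n)
  set L := hsub.lim
  have hlower : ∀ n : ℕ, Real.exp (L * n) ≤ (words Z n).card := by
    intro n
    rw [← Real.le_log_iff_exp_le (hlpos n)]
    rcases Nat.eq_zero_or_pos n with rfl | hn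
    · simpa using hl0 0
    · rw [← le_div_iff₀ (by exact_mod_cast hn)]
      exact hsub.lim_le_div hbdd hn.ne'
  set γ : ℝ := (1 - s) * Real.log 2 / 3 with hγ
  have hlog2 : 0 < Real.log 2 := Real.log_pos one_lt_two
  have hγ0 : 0 < γ := by
    have : 0 < 1 - (s : ℝ) := by linarith
    positivity
  obtain ⟨M₀, hM₀⟩ : ∃ M₀ : ℕ, ∀ n ≥ M₀, l n / n < L + γ := by
    have := (hsub.tendsto_lim hbdd).eventually_lt_const (show L < L + γ by linarith)
    exact Filter.eventually_atTop.1 this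
  have hupper : ∀ n ≥ max M₀ 1, ((words Z n).card : ℝ) ≤ Real.exp ((L + γ) * n) := by
    intro n hn
    have hn0 : (0 : ℝ) < n := by
      have := le_of_max_le_right hn
      exact_mod_cast this
    rw [← Real.log_le_iff_le_exp (hlpos n), ← div_le_iff₀ hn0]
    exact (hM₀ n (le_of_max_le_left hn)).le
  -- the efficient cover and its weight function
  obtain ⟨J, u, m, hmM, hcov, hsum⟩ := hcomp.exists_dyadic_cover_of_hausdorffMeasure_eq_zero
    hs0 hs1.le hμ (η := γ / 48) (by positivity) (max M₀ 1)
  set θ : ℝ := Real.exp (L - 2 * γ) with hθ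
  have hθ0 : 0 < θ := Real.exp_pos _
  set c : AddCircle (1 : ℝ) → ℝ := fun x => ∑ i ∈ J, ∑ w ∈ words Z (m i),
    (θ ^ m i)⁻¹ * circleBump (u i - ((w / 2 ^ m i : ℝ) : AddCircle (1 : ℝ))) ((1 / 2) ^ m i) x
    with hc
  have hc0 : ∀ x, 0 ≤ c x := fun x => Finset.sum_nonneg fun i _ => Finset.sum_nonneg fun w _ =>
    mul_nonneg (by positivity) (circleBump_nonneg _ _ _)
  have hcc : ∀ i (w : ℕ), Continuous fun x => (θ ^ m i)⁻¹ *
      circleBump (u i - ((w / 2 ^ m i : ℝ) : AddCircle (1 : ℝ))) ((1 / 2) ^ m i) x := fun i w =>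
    continuous_const.mul (continuous_circleBump _ _)
  have hccont : Continuous c :=
    continuous_finsetSum _ fun i _ => continuous_finsetSum _ fun w _ => hcc i w
  have hint : ∀ g : AddCircle (1 : ℝ) → ℝ, Continuous g → Integrable g := fun g hg =>
    hg.integrable_of_hasCompactSupport (HasCompactSupport.of_compactSpace _)
  have hcint : ∫ x, c x ≤ γ / 2 := by
    have e : ∫ x, c x = ∑ i ∈ J, ∑ w ∈ words Z (m i), (θ ^ m i)⁻¹ *
        ∫ x, circleBump (u i - ((w / 2 ^ m i : ℝ) : AddCircle (1 : ℝ))) ((1 / 2) ^ m i) x := by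
      simp only [hc]
      rw [integral_finsetSum _ fun i _ => hint _ (continuous_finsetSum _ fun w _ => hcc i w)]
      refine Finset.sum_congr rfl fun i _ => ?_
      rw [integral_finsetSum _ fun w _ => hint _ (hcc i w)]
      exact Finset.sum_congr rfl fun w _ => integral_const_mul _ _
    rw [e]
    have hb : ∀ i ∈ J, ∑ w ∈ words Z (m i), (θ ^ m i)⁻¹ *
        ∫ x, circleBump (u i - ((w / 2 ^ m i : ℝ) : AddCircle (1 : ℝ))) ((1 / 2) ^ m i) x
        ≤ 24 * (((1 / 2 : ℝ) ^ m i) ^ (s : ℝ)) := by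
      intro i _
      have h1 : ∀ w ∈ words Z (m i), (θ ^ m i)⁻¹ *
        ∫ x, circleBump (u i - ((w / 2 ^ m i : ℝ) : AddCircle (1 : ℝ))) ((1 / 2) ^ m i) x
          ≤ (θ ^ m i)⁻¹ * (24 * (1 / 2) ^ m i) := fun w _ => by
        gcongr
        exact integral_circleBump_le _ (by positivity)
      refine (Finset.sum_le_sum h1).trans ?_
      rw [Finset.sum_const, nsmul_eq_mul]
      have h2 : (1 / 2 : ℝ) ^ m i = Real.exp (-(Real.log 2 * m i)) := by
        rw [Real.exp_neg, mul_comm, Real.exp_nat_mul, Real.exp_log two_pos, one_div, inv_pow]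
      have h3 : (θ ^ m i)⁻¹ = Real.exp (-((L - 2 * γ) * m i)) := by
        rw [Real.exp_neg, mul_comm _ (m i : ℝ), Real.exp_nat_mul]
      calc ((words Z (m i)).card : ℝ) * ((θ ^ m i)⁻¹ * (24 * (1 / 2) ^ m i))
          ≤ Real.exp ((L + γ) * m i) * ((θ ^ m i)⁻¹ * (24 * (1 / 2) ^ m i)) := by
            gcongr
            exact hupper _ (hmM i)
        _ = 24 * Real.exp ((L + γ) * m i + -((L - 2 * γ) * m i) + -(Real.log 2 * m i)) := by
            rw [h2, h3, Real.exp_add, Real.exp_add]; ring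
        _ = 24 * (((1 / 2 : ℝ) ^ m i) ^ (s : ℝ)) := by
            rw [h2, ← Real.exp_mul, hγ]
            congr 2
            ring
    refine (Finset.sum_le_sum hb).trans ?_
    rw [← Finset.mul_sum]
    linarith
  obtain ⟨N₀, hN₀⟩ := PolySeq.sum_le_of_integral_le d ha hccont (by positivity) hcint
  set δ : ℝ := (1 / 2) ^ J.sup m
  obtain ⟨K, hK0, hK⟩ := exists_card_fiberWords_le (Z := Z) (τ := τ) (φ := φ) hZ
    (fun i => (le_max_right _ _).trans (hmM i))
    (fun p hp => by
      have := hcov (Set.mem_image_of_mem _ hp)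
      simp only [Set.mem_iUnion, exists_prop] at this
      obtain ⟨i, hi, hpi⟩ := this
      rw [Metric.mem_ball, dist_eq_norm] at hpi
      exact ⟨i, hi, hpi.le⟩)
    (δ := δ) (fun i hi => pow_le_pow_of_le_one (by norm_num) (by norm_num) (Finset.le_sup hi))
    hθ0 hc0 (fun x => by
      refine Finset.sum_le_sum fun i _ => Finset.sum_le_sum fun w _ => ?_
      split_ifs with h
      · have := one_le_circleBump (by positivity) h
        have h2 : 0 < (θ ^ m i)⁻¹ := by positivity
        nlinarith
      · exact mul_nonneg (by positivity) (circleBump_nonneg _ _ _))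
  obtain ⟨C, q, hG⟩ := hgrid δ (by positivity)
  obtain ⟨N, hN, hNexp⟩ := exists_poly_lt_exp (C * K) q N₀ hγ0
  obtain ⟨G, hGcard, hGx⟩ := hG N
  have hcount : (words Z N).card ≤
      ∑ z ∈ G, (fiberWords Z τ φ δ N fun j => φ (τ^[j] z)).card := by
    refine le_trans (Finset.card_le_card fun w hw => ?_) Finset.card_biUnion_le
    obtain ⟨p, hp, rfl⟩ := mem_words.1 hw
    obtain ⟨z, hz, hpz⟩ := hGx p.1
    exact Finset.mem_biUnion.2 ⟨z, hz, mem_fiberWords.2 ⟨p, hp, hpz, rfl⟩⟩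
  have hfin : ((words Z N).card : ℝ) ≤
      C * (N + 1) ^ q * (K * θ ^ N * Real.exp (γ * N)) := by
    refine (Nat.cast_le.2 hcount).trans ?_
    rw [Nat.cast_sum]
    have h1 : ∀ z ∈ G, ((fiberWords Z τ φ δ N fun j => φ (τ^[j] z)).card : ℝ) ≤
        K * θ ^ N * Real.exp (γ * N) := by
      intro z _
      refine (hK N _).trans ?_
      have := hN₀ N hN _ (hpoly z)
      gcongr
      linarith
    refine (Finset.sum_le_sum h1).trans ?_
    rw [Finset.sum_const, nsmul_eq_mul]
    gcongr
    exact_mod_cast hGcard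
  have hθN : θ ^ N = Real.exp (L * N) * Real.exp (-(γ * N)) * Real.exp (-(γ * N)) := by
    rw [hθ, ← Real.exp_nat_mul, ← Real.exp_add, ← Real.exp_add]
    congr 1; ring
  have h1 := (hlower N).trans hfin
  have h2 : C * ((N : ℝ) + 1) ^ q * (K * θ ^ N * Real.exp (γ * N)) =
      Real.exp (L * N) * ((C * K * ((N : ℝ) + 1) ^ q) * Real.exp (-(γ * N))) := by
    have h3 : Real.exp (-(γ * N)) * Real.exp (γ * N) = 1 := by rw [← Real.exp_add]; simp
    rw [hθN]
    linear_combination (Real.exp (L * N) * Real.exp (-(γ * N)) * C * K * ((N : ℝ) + 1) ^ q) * h3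
  rw [h2] at h1
  have h3 : C * K * ((N : ℝ) + 1) ^ q * Real.exp (-(γ * N)) < 1 := by
    rw [Real.exp_neg, ← div_eq_mul_inv, div_lt_one (Real.exp_pos _)]
    exact hNexp
  nlinarith [Real.exp_pos (L * N)]

/-- The skew product `(x₁, …, x_k) ↦ (x₁ + α, x₂ + x₁, …, x_k + x_{k-1})` on a power of a group. -/
def skewMap {G : Type*} [Add G] (a : G) (k : ℕ) (x : Fin k → G) : Fin k → G :=
  fun i => if _h : (i : ℕ) = 0 then x i + a
    else x i + x ⟨(i : ℕ) - 1, lt_of_le_of_lt (Nat.sub_le _ _) i.2⟩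

lemma polySeq_skewMap_iterate {G : Type*} [AddCommGroup G] (a : G) (k : ℕ) (x : Fin k → G)
    (i : ℕ) (hi : i < k) : PolySeq a (i + 1) fun n => (skewMap a k)^[n] x ⟨i, hi⟩ := by
  induction i with
  | zero =>
    intro n
    dsimp only
    rw [Function.iterate_succ_apply', skewMap, dif_pos rfl, add_sub_cancel_left]
  | succ i ih =>
    have := ih (by omega)
    rw [PolySeq]
    convert this using 2 with n
    rw [Function.iterate_succ_apply', skewMap, dif_neg (Nat.succ_ne_zero i), add_sub_cancel_left]
    rfl

lemma norm_skewMap_iterate_sub_le {G : Type*} [SeminormedAddCommGroup G] (a : G) {k : ℕ}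
    {x z : Fin k → G} {r : ℝ} (h : ∀ i, ‖x i - z i‖ ≤ r) (n : ℕ) (i : Fin k) :
    ‖(skewMap a k)^[n] x i - (skewMap a k)^[n] z i‖ ≤ ((n : ℝ) + 1) ^ (i : ℕ) * r := by
  have hr : 0 ≤ r := (norm_nonneg _).trans (h i)
  induction n generalizing i with
  | zero => simpa using h i
  | succ n ih =>
    rw [Function.iterate_succ_apply', Function.iterate_succ_apply']
    set X := (skewMap a k)^[n] x
    set Y := (skewMap a k)^[n] z
    by_cases hi : (i : ℕ) = 0
    · have := ih i
      rw [skewMap, skewMap, dif_pos hi, dif_pos hi, add_sub_add_right_eq_sub]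
      simpa [hi] using this
    · rw [skewMap, skewMap, dif_neg hi, dif_neg hi, add_sub_add_comm]
      refine (norm_add_le _ _).trans ((add_le_add (ih _) (ih _)).trans ?_)
      dsimp only
      obtain ⟨j, hj⟩ : ∃ j, (i : ℕ) = j + 1 := ⟨i - 1, by omega⟩
      rw [hj, Nat.add_sub_cancel, ← add_mul]
      gcongr
      push_cast
      have h1 : ((n : ℝ) + 1) ^ j ≤ ((n : ℝ) + 1 + 1) ^ j := by gcongr; linarith
      have h2 : (0 : ℝ) ≤ (n : ℝ) + 1 + 1 := by positivity
      rw [pow_succ, pow_succ]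
      nlinarith

lemma exists_skewMap_shadowing (a : AddCircle (1 : ℝ)) (k : ℕ) (i : Fin k) {δ : ℝ} (hδ : 0 < δ) :
    ∃ C q : ℕ, ∀ N : ℕ, ∃ G : Finset (Fin k → AddCircle (1 : ℝ)), G.card ≤ C * (N + 1) ^ q ∧
      ∀ x, ∃ z ∈ G, ∀ j < N, ‖(skewMap a k)^[j] x i - (skewMap a k)^[j] z i‖ ≤ δ := by
  classical
  obtain ⟨E, hE⟩ := exists_nat_gt (1 / δ)
  have hE0 : (0 : ℝ) < E := lt_trans (by positivity) hE
  refine ⟨E ^ k, k * k, fun N => ?_⟩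
  set R : ℕ := E * (N + 1) ^ k with hR
  have hR0 : 0 < R := Nat.mul_pos (by exact_mod_cast hE0) (by positivity)
  refine ⟨(Fintype.piFinset fun _ : Fin k => Finset.range R).image
    fun b i => ((b i / R : ℝ) : AddCircle (1 : ℝ)), ?_, fun x => ?_⟩
  · refine Finset.card_image_le.trans (le_of_eq ?_)
    rw [Fintype.card_piFinset_const, Finset.card_range, hR, mul_pow, pow_mul]
  · refine ⟨_, Finset.mem_image.2 ⟨fun i => ⌊(R : ℝ) * (AddCircle.equivIco (1 : ℝ) 0 (x i) : ℝ)⌋₊,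
      Fintype.mem_piFinset.2 fun i => Finset.mem_range.2 (floor_mul_equivIco_lt hR0 _), rfl⟩,
      fun j hj => ?_⟩
    refine (norm_skewMap_iterate_sub_le a
      (fun i => norm_sub_floor_mul_equivIco_le hR0 (x i)) j i).trans ?_
    have h1 : ((j : ℝ) + 1) ^ (i : ℕ) ≤ ((N : ℝ) + 1) ^ k := by
      have hjN : (j : ℝ) ≤ N := by exact_mod_cast hj.le
      calc ((j : ℝ) + 1) ^ (i : ℕ) ≤ ((N : ℝ) + 1) ^ (i : ℕ) := by gcongr
        _ ≤ ((N : ℝ) + 1) ^ k := pow_le_pow_right₀ (by simp) i.2.le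
    have h2 : (R : ℝ) = E * ((N : ℝ) + 1) ^ k := by rw [hR]; push_cast; ring
    calc ((j : ℝ) + 1) ^ (i : ℕ) * (1 / R) ≤ ((N : ℝ) + 1) ^ k * (1 / R) := by gcongr
      _ = 1 / E := by rw [h2]; field_simp
      _ ≤ δ := by
        rw [div_le_iff₀ hE0]
        rw [div_lt_iff₀ hδ] at hE
        linarith

lemma dimH_addCircle_le_one (S : Set (AddCircle (1 : ℝ))) : dimH S ≤ 1 := by
  have hlip : LipschitzWith 1 ((↑) : ℝ → AddCircle (1 : ℝ)) := by
    refine LipschitzWith.of_dist_le_mul fun x y => ?_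
    rw [NNReal.coe_one, one_mul, dist_eq_norm, dist_eq_norm, ← AddCircle.coe_sub]
    exact QuotientAddGroup.norm_mk_le_norm
  calc dimH S ≤ dimH (Set.univ : Set (AddCircle (1 : ℝ))) := dimH_mono (Set.subset_univ _)
    _ = dimH (((↑) : ℝ → AddCircle (1 : ℝ)) '' Set.univ) := by
      rw [Set.image_univ, (QuotientAddGroup.mk_surjective).range_eq]
    _ ≤ dimH (Set.univ : Set ℝ) := hlip.dimH_image_le _
    _ = 1 := Real.dimH_univ

lemma zsmul_coe_addCircle_ne_zero {α : ℝ} (hα : Irrational α) {m : ℤ} (hm : m ≠ 0) :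
    m • (α : AddCircle (1 : ℝ)) ≠ 0 := by
  intro h
  rw [← AddCircle.coe_zsmul, AddCircle.coe_eq_zero_iff] at h
  obtain ⟨n, hn⟩ := h
  rw [zsmul_one, zsmul_eq_mul] at hn
  exact (hα.intCast_mul hm).ne_int n hn.symm

/-- Let `α ∈ (0,1)` be irrational, `k ≥ 1`, and `Z ⊆ 𝕋^k × 𝕋` a nonempty
closed set invariant under the skew product
`S(x₁, …, x_k, y) = (x₁ + α, x₂ + x₁, …, x_k + x_{k-1}, 2y)`.
Then `{x_k + y : (x₁, …, x_k, y) ∈ Z}` has Hausdorff dimension `1`.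
(We index the `x`-coordinates by `Fin k`, so `x_k` is coordinate `k - 1`.) -/
theorem dimH_sum_of_invariant_set_skew (α : ℝ) (hα : Irrational α) (h0 : 0 < α) (h1 : α < 1)
    (k : ℕ) (hk : 1 ≤ k)
    (Z : Set ((Fin k → AddCircle (1 : ℝ)) × AddCircle (1 : ℝ)))
    (hZne : Z.Nonempty) (hZcl : IsClosed Z)
    (hZinv : (fun p : (Fin k → AddCircle (1 : ℝ)) × AddCircle (1 : ℝ) =>
        ((fun i : Fin k => if h : (i : ℕ) = 0 then p.1 i + (α : AddCircle (1 : ℝ))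
            else p.1 i + p.1 ⟨(i : ℕ) - 1, lt_of_le_of_lt (Nat.sub_le _ _) i.2⟩),
          (2 : ℤ) • p.2)) '' Z ⊆ Z) :
    dimH ((fun p : (Fin k → AddCircle (1 : ℝ)) × AddCircle (1 : ℝ) =>
        p.1 ⟨k - 1, Nat.sub_lt hk one_pos⟩ + p.2) '' Z) = 1 := by
  refine le_antisymm (dimH_addCircle_le_one _) ?_
  refine one_le_dimH_of_invariant (τ := skewMap (α : AddCircle (1 : ℝ)) k)
    (φ := fun x => x ⟨k - 1, Nat.sub_lt hk one_pos⟩) (d := k - 1) (a := (α : AddCircle (1 : ℝ)))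
    hZne (fun p hp => ?_) ?_ (fun m hm => zsmul_coe_addCircle_ne_zero hα hm)
    (fun x => polySeq_skewMap_iterate _ k x _ _)
    (fun δ hδ => exists_skewMap_shadowing _ k _ hδ)
  · have := hZinv (Set.mem_image_of_mem _ hp)
    rwa [ofNat_zsmul] at this
  · exact hZcl.isCompact.image (by fun_prop)
end
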